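/- arXiv:1012.5493 — 2 statements merged into one kernel-verified Lean document; each statement's English description precedes it below -/
import Mathlib

section
/- Let F = F_{α,φ} be an Anzai skew product satisfying conditions (3.1)–(3.4). Then the three sets D, P and N are nonempty, pairwise disjoint Borel subsets of ℝ/ℤ, and D ∪ P ∪ N = ℝ/ℤ. -/
open Filter Topology MeasureTheory

noncomputable section

/-- The Anzai skew product `F(x,y) = (x+α, y+φ(x))` on `(ℝ/ℤ) × ℝ`, as a bijection. -/
def anzai (α : ℝ) (φ : AddCircle (1 : ℝ) → ℝ) : Equiv.Perm (AddCircle (1 : ℝ) × ℝ) where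
  toFun z := (z.1 + (α : AddCircle (1 : ℝ)), z.2 + φ z.1)
  invFun z := (z.1 - (α : AddCircle (1 : ℝ)), z.2 - φ (z.1 - (α : AddCircle (1 : ℝ))))
  left_inv z := by simp
  right_inv z := by simp

/-- The limit set `λ(z)` of a point `z` under the Anzai skew product: all limits of sequences
`F^{n_k}(z)` with `|n_k| → ∞` (the union of the α-limit and ω-limit sets). -/
def limitSet (α : ℝ) (φ : AddCircle (1 : ℝ) → ℝ) (z : AddCircle (1 : ℝ) × ℝ) :
    Set (AddCircle (1 : ℝ) × ℝ) :=
  {w | ∃ n : ℕ → ℤ, Tendsto (fun k => |n k|) atTop atTop ∧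
    Tendsto (fun k => ((anzai α φ) ^ (n k)) z) atTop (𝓝 w)}

/-- Poincaré's set `𝓛_x = { y ∈ ℝ : (x,y) ∈ λ(x,0) }`. -/
def Lx (α : ℝ) (φ : AddCircle (1 : ℝ) → ℝ) (x : AddCircle (1 : ℝ)) : Set ℝ :=
  {y | ((x, y) : AddCircle (1 : ℝ) × ℝ) ∈ limitSet α φ (x, 0)}

/-- `φ : ℝ/ℤ → ℝ` is absolutely continuous: there is `g ∈ L¹` with
`φ(x) − φ(0) = ∫₀ˣ g(t) dt` for all `x ∈ [0,1]`. -/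
def AbsolutelyContinuous' (φ : AddCircle (1 : ℝ) → ℝ) : Prop :=
  ∃ g : ℝ → ℝ, IntegrableOn g (Set.Icc 0 1) ∧
    ∀ x ∈ Set.Icc (0 : ℝ) 1, φ (x : ℝ) - φ ((0 : ℝ) : AddCircle (1 : ℝ)) = ∫ t in (0 : ℝ)..x, g t

/-- Conditions (3.1)–(3.4): `α` irrational, `φ` continuous with zero mean, the cohomological
equation `h ∘ R_α − h = φ` has no continuous solution, and `φ` is absolutely continuous. -/
def AnzaiConds (α : ℝ) (φ : AddCircle (1 : ℝ) → ℝ) : Prop :=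
  Irrational α ∧ Continuous φ ∧ (∫ x : AddCircle (1 : ℝ), φ x = 0) ∧
  (¬ ∃ h : AddCircle (1 : ℝ) → ℝ, Continuous h ∧
      ∀ x, h (x + (α : AddCircle (1 : ℝ))) - h x = φ x) ∧
  AbsolutelyContinuous' φ

/-! ### The cocycle of Birkhoff sums -/

/-- The two-sided Birkhoff sums of `φ`: the fibre coordinate of `F^n (x, 0)`. -/
def birkhoffCocycle (α : ℝ) (φ : AddCircle (1 : ℝ) → ℝ) (n : ℤ) (x : AddCircle (1 : ℝ)) : ℝ :=
  ((anzai α φ ^ n) (x, 0)).2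

section Cocycle

variable {α : ℝ} {φ : AddCircle (1 : ℝ) → ℝ}

theorem anzai_zpow_apply (n : ℤ) (x : AddCircle (1 : ℝ)) (y : ℝ) :
    (anzai α φ ^ n) (x, y) =
      (x + n • (α : AddCircle (1 : ℝ)), y + birkhoffCocycle α φ n x) := by
  unfold birkhoffCocycle
  induction n generalizing x y with
  | zero => simp
  | succ n ih =>
    have key : ∀ z, (anzai α φ ^ ((n : ℤ) + 1)) z = (anzai α φ ^ (n : ℤ)) (anzai α φ z) := by
      intro z; rw [zpow_add_one]; rfl
    have hF : ∀ y, anzai α φ (x, y) = (x + (α : AddCircle (1 : ℝ)), y + φ x) := fun y => rfl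
    rw [key, key, hF, hF, ih, ih _ (0 + φ x)]
    ext
    · simp [add_smul]; abel
    · simp; ring
  | pred n ih =>
    have key : ∀ z, (anzai α φ ^ (-(n : ℤ) - 1)) z
        = (anzai α φ ^ (-(n : ℤ))) ((anzai α φ).symm z) := by
      intro z; rw [zpow_sub_one]; rfl
    have hF : ∀ y, (anzai α φ).symm (x, y)
        = (x - (α : AddCircle (1 : ℝ)), y - φ (x - (α : AddCircle (1 : ℝ)))) := fun y => rfl
    rw [key, key, hF, hF, ih, ih _ (0 - φ _)]
    ext
    · simp only [sub_smul, one_smul]; abel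
    · simp; ring

@[simp]
theorem birkhoffCocycle_zero (x : AddCircle (1 : ℝ)) : birkhoffCocycle α φ 0 x = 0 := by
  simp [birkhoffCocycle]

theorem birkhoffCocycle_one (x : AddCircle (1 : ℝ)) : birkhoffCocycle α φ 1 x = φ x := by
  simp [birkhoffCocycle, anzai]

theorem birkhoffCocycle_add (m n : ℤ) (x : AddCircle (1 : ℝ)) :
    birkhoffCocycle α φ (m + n) x =
      birkhoffCocycle α φ m x + birkhoffCocycle α φ n (x + m • (α : AddCircle (1 : ℝ))) := by
  have h : (anzai α φ ^ (m + n)) (x, 0) = (anzai α φ ^ n) ((anzai α φ ^ m) (x, 0)) := by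
    rw [add_comm, zpow_add]; rfl
  have h2 := congrArg Prod.snd h
  simpa [anzai_zpow_apply] using h2

theorem birkhoffCocycle_neg (n : ℤ) (x : AddCircle (1 : ℝ)) :
    birkhoffCocycle α φ (-n) x =
      -birkhoffCocycle α φ n (x - n • (α : AddCircle (1 : ℝ))) := by
  have h := birkhoffCocycle_add (α := α) (φ := φ) (-n) n x
  simp only [neg_add_cancel, birkhoffCocycle_zero, neg_smul, ← sub_eq_add_neg] at h
  linarith

theorem birkhoffCocycle_natCast (q : ℕ) (x : AddCircle (1 : ℝ)) :
    birkhoffCocycle α φ q x =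
      ∑ i ∈ Finset.range q, φ (x + i • (α : AddCircle (1 : ℝ))) := by
  induction q with
  | zero => simp
  | succ q ih =>
    rw [Finset.sum_range_succ, Nat.cast_succ, birkhoffCocycle_add, ih, birkhoffCocycle_one,
      natCast_zsmul]

theorem continuous_birkhoffCocycle (hφ : Continuous φ) (n : ℤ) :
    Continuous (birkhoffCocycle α φ n) := by
  have hnat : ∀ q : ℕ, Continuous (birkhoffCocycle α φ q) := by
    intro q
    rw [funext (birkhoffCocycle_natCast q)]
    fun_prop
  obtain ⟨q, rfl | rfl⟩ := n.eq_nat_or_neg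
  · exact hnat q
  · rw [funext (birkhoffCocycle_neg (q : ℤ))]
    have := hnat q
    fun_prop

/-- The base rotation has arbitrarily long return times along which the Birkhoff sums are
uniformly small. -/
def UniformlyRecurrent (α : ℝ) (φ : AddCircle (1 : ℝ) → ℝ) : Prop :=
  ∀ ε > 0, ∀ N : ℕ, ∃ q : ℕ, N ≤ q ∧ ‖(q : ℤ) • (α : AddCircle (1 : ℝ))‖ < ε ∧
    ∀ x, |birkhoffCocycle α φ q x| < ε

/-- The closure of the orbit of `(x, 0)`. -/
def orbitClosure (α : ℝ) (φ : AddCircle (1 : ℝ) → ℝ) (x : AddCircle (1 : ℝ)) :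
    Set (AddCircle (1 : ℝ) × ℝ) :=
  closure (Set.range fun n : ℤ =>
    (x + n • (α : AddCircle (1 : ℝ)), birkhoffCocycle α φ n x))

theorem mem_orbitClosure_iff {x t : AddCircle (1 : ℝ)} {y : ℝ} :
    (t, y) ∈ orbitClosure α φ x ↔ ∀ ε > 0, ∃ n : ℤ,
      ‖x + n • (α : AddCircle (1 : ℝ)) - t‖ < ε ∧ |birkhoffCocycle α φ n x - y| < ε := by
  rw [orbitClosure, Metric.mem_closure_range_iff]
  refine forall₂_congr fun ε _ => exists_congr fun n => ?_
  rw [dist_comm, Prod.dist_eq, max_lt_iff, dist_eq_norm, Real.dist_eq]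

theorem mem_Lx_iff_mem_orbitClosure (hR : UniformlyRecurrent α φ) {x : AddCircle (1 : ℝ)}
    {y : ℝ} : y ∈ Lx α φ x ↔ (x, y) ∈ orbitClosure α φ x := by
  have hF : ∀ n : ℤ, (anzai α φ ^ n) (x, 0) =
      (x + n • (α : AddCircle (1 : ℝ)), birkhoffCocycle α φ n x) := fun n => by
    rw [anzai_zpow_apply, zero_add]
  constructor
  · rintro ⟨n, -, hn⟩
    exact mem_closure_of_tendsto hn (Eventually.of_forall fun k => ⟨n k, (hF _).symm⟩)
  · intro h
    rw [mem_orbitClosure_iff] at h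
    have hk : ∀ k : ℕ, ∃ n : ℤ, (k : ℤ) ≤ |n| ∧
        ‖x + n • (α : AddCircle (1 : ℝ)) - x‖ < 1 / (k + 1) + 1 / (k + 1) ∧
        |birkhoffCocycle α φ n x - y| < 1 / ((k : ℝ) + 1) + 1 / (k + 1) := by
      intro k
      have hpos : (0 : ℝ) < 1 / ((k : ℝ) + 1) := by positivity
      obtain ⟨n, hn1, hn2⟩ := h _ hpos
      obtain ⟨q, hq, hq1, hq2⟩ := hR _ hpos (k + n.natAbs)
      refine ⟨n + q, ?_, ?_, ?_⟩
      · have : (k : ℤ) ≤ n + q := by omega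
        exact this.trans (le_abs_self _)
      · have : x + (n + (q : ℤ)) • (α : AddCircle (1 : ℝ)) - x =
            (x + n • (α : AddCircle (1 : ℝ)) - x) + (q : ℤ) • (α : AddCircle (1 : ℝ)) := by
          rw [add_smul]; abel
        rw [this]
        exact (norm_add_le _ _).trans_lt (add_lt_add hn1 hq1)
      · rw [birkhoffCocycle_add, add_sub_right_comm]
        exact (abs_add_le _ _).trans_lt (add_lt_add hn2 (hq2 _))
    choose n hn hn1 hn2 using hk
    have hlim : Tendsto (fun k : ℕ => 1 / ((k : ℝ) + 1) + 1 / (k + 1)) atTop (𝓝 0) := by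
      simpa using tendsto_one_div_add_atTop_nhds_zero_nat (𝕜 := ℝ).add
        tendsto_one_div_add_atTop_nhds_zero_nat
    refine ⟨n, tendsto_atTop_mono hn tendsto_natCast_atTop_atTop, ?_⟩
    simp only [hF]
    refine Tendsto.prodMk_nhds ?_ ?_
    · rw [tendsto_iff_norm_sub_tendsto_zero]
      exact squeeze_zero (fun _ => norm_nonneg _) (fun k => (hn1 k).le) hlim
    · rw [tendsto_iff_norm_sub_tendsto_zero]
      exact squeeze_zero (fun _ => norm_nonneg _) (fun k => (hn2 k).le) hlim

theorem isClosed_Lx (hR : UniformlyRecurrent α φ) (x : AddCircle (1 : ℝ)) :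
    IsClosed (Lx α φ x) := by
  have : Lx α φ x = (fun y : ℝ => (x, y)) ⁻¹' orbitClosure α φ x :=
    Set.ext fun y => mem_Lx_iff_mem_orbitClosure hR
  rw [this]
  exact isClosed_closure.preimage (by fun_prop)

theorem mem_Lx_iff (hR : UniformlyRecurrent α φ) {x : AddCircle (1 : ℝ)} {y : ℝ} :
    y ∈ Lx α φ x ↔ ∀ ε > 0, ∃ n : ℤ,
      ‖n • (α : AddCircle (1 : ℝ))‖ < ε ∧ |birkhoffCocycle α φ n x - y| < ε := by
  rw [mem_Lx_iff_mem_orbitClosure hR, mem_orbitClosure_iff]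
  simp

theorem zero_mem_Lx (hR : UniformlyRecurrent α φ) (x : AddCircle (1 : ℝ)) :
    (0 : ℝ) ∈ Lx α φ x := by
  rw [mem_Lx_iff hR]
  exact fun ε hε => ⟨0, by simpa, by simpa⟩

theorem orbitClosure_anzai_mem (hφ : Continuous φ) {x t : AddCircle (1 : ℝ)} {y : ℝ}
    (h : (t, y) ∈ orbitClosure α φ x) (m : ℤ) :
    (t + m • (α : AddCircle (1 : ℝ)), y + birkhoffCocycle α φ m t) ∈ orbitClosure α φ x := by
  have hc : Continuous fun w : AddCircle (1 : ℝ) × ℝ =>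
      (w.1 + m • (α : AddCircle (1 : ℝ)), w.2 + birkhoffCocycle α φ m w.1) := by
    have := continuous_birkhoffCocycle (α := α) hφ m
    fun_prop
  refine map_mem_closure (x := (t, y)) hc h ?_
  rintro _ ⟨n, rfl⟩
  refine ⟨n + m, ?_⟩
  simp only [birkhoffCocycle_add, add_smul, add_assoc]

theorem orbitClosure_add_mem (hφ : Continuous φ) (hR : UniformlyRecurrent α φ)
    {x t : AddCircle (1 : ℝ)} {y z : ℝ} (hy : y ∈ Lx α φ x) (h : (t, z) ∈ orbitClosure α φ x) :
    (t, z + y) ∈ orbitClosure α φ x := by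
  have hc : Continuous fun w : AddCircle (1 : ℝ) × ℝ => (w.1, w.2 + y) := by fun_prop
  have := map_mem_closure (t := orbitClosure α φ x) hc h ?_
  · rwa [orbitClosure, closure_closure] at this
  · rintro _ ⟨n, rfl⟩
    have := orbitClosure_anzai_mem hφ ((mem_Lx_iff_mem_orbitClosure hR).1 hy) n
    simpa [add_comm] using this

theorem add_mem_Lx (hφ : Continuous φ) (hR : UniformlyRecurrent α φ) {x : AddCircle (1 : ℝ)}
    {y z : ℝ} (hy : y ∈ Lx α φ x) (hz : z ∈ Lx α φ x) : y + z ∈ Lx α φ x := by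
  rw [mem_Lx_iff_mem_orbitClosure hR] at hy ⊢
  exact orbitClosure_add_mem hφ hR hz hy

theorem nsmul_mem_Lx (hφ : Continuous φ) (hR : UniformlyRecurrent α φ) {x : AddCircle (1 : ℝ)}
    {y : ℝ} (hy : y ∈ Lx α φ x) (k : ℕ) : k * y ∈ Lx α φ x := by
  induction k with
  | zero => simpa using zero_mem_Lx hR x
  | succ k ih => simpa [add_mul] using add_mem_Lx hφ hR ih hy

theorem Lx_subset_Lx_add (hφ : Continuous φ) (hR : UniformlyRecurrent α φ)
    (x : AddCircle (1 : ℝ)) (m : ℤ) :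
    Lx α φ x ⊆ Lx α φ (x + m • (α : AddCircle (1 : ℝ))) := by
  intro y hy
  rw [mem_Lx_iff hR] at hy ⊢
  intro ε hε
  obtain ⟨δ, hδ, hc⟩ := Metric.continuousAt_iff.1
    ((continuous_birkhoffCocycle (α := α) hφ m).continuousAt (x := x)) (ε / 2) (half_pos hε)
  obtain ⟨n, hn1, hn2⟩ := hy (min δ (ε / 2)) (by positivity)
  refine ⟨n, hn1.trans_le ((min_le_right _ _).trans (by linarith)), ?_⟩
  have h1 : |birkhoffCocycle α φ m (x + n • (α : AddCircle (1 : ℝ))) -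
      birkhoffCocycle α φ m x| < ε / 2 := by
    rw [← Real.dist_eq]
    apply hc
    rw [dist_eq_norm, add_sub_cancel_left]
    exact hn1.trans_le (min_le_left _ _)
  have h2 := hn2.trans_le (min_le_right _ _)
  have h3 := birkhoffCocycle_add (α := α) (φ := φ) m n x
  rw [add_comm m n, birkhoffCocycle_add] at h3
  rw [abs_lt] at *
  constructor <;> linarith

end Cocycle

/-! ### Structure of the sets `𝓛_x` -/

/-- A closed additive semigroup of reals with arbitrarily small positive elements contains all
nonnegative reals. -/
theorem Ici_subset_of_arbitrarily_small {L : Set ℝ} (hL : IsClosed L)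
    (hmul : ∀ y ∈ L, ∀ k : ℕ, (k : ℝ) * y ∈ L) (hsmall : ∀ ε > 0, ∃ y ∈ L, 0 < y ∧ y < ε) :
    Set.Ici 0 ⊆ L := by
  intro z hz
  rw [← hL.closure_eq, Metric.mem_closure_iff]
  intro ε hε
  obtain ⟨y, hy, hy0, hyε⟩ := hsmall ε hε
  refine ⟨_, hmul y hy ⌊z / y⌋₊, ?_⟩
  have h1 : (⌊z / y⌋₊ : ℝ) * y ≤ z :=
    (le_div_iff₀ hy0).1 (Nat.floor_le (div_nonneg hz hy0.le))
  have h2 : z < ((⌊z / y⌋₊ : ℝ) + 1) * y := (div_lt_iff₀ hy0).1 (Nat.lt_floor_add_one _)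
  rw [Real.dist_eq, abs_lt]
  constructor <;> linarith

theorem AddCircle.exists_coe_eq_abs_eq_norm (t : AddCircle (1 : ℝ)) :
    ∃ r : ℝ, (r : AddCircle (1 : ℝ)) = t ∧ |r| = ‖t‖ := by
  induction t using QuotientAddGroup.induction_on with
  | H r =>
    refine ⟨r - round r, ?_, (UnitAddCircle.norm_eq).symm⟩
    rw [AddCircle.coe_sub, sub_eq_self, AddCircle.coe_eq_zero_iff]
    exact ⟨round r, by simp⟩

theorem AddCircle.norm_coe_le_abs (r : ℝ) : ‖(r : AddCircle (1 : ℝ))‖ ≤ |r| := by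
  rw [UnitAddCircle.norm_eq]
  simpa using round_le r 0

section Structure

variable {α : ℝ} {φ : AddCircle (1 : ℝ) → ℝ}

theorem UniformlyRecurrent.exists_small_translation (hα : Irrational α)
    (hR : UniformlyRecurrent α φ) {ε : ℝ} (hε : 0 < ε) :
    ∃ (n : ℤ) (β : ℝ), 0 < |β| ∧ |β| < ε ∧ (β : AddCircle (1 : ℝ)) =
      n • (α : AddCircle (1 : ℝ)) ∧ ∀ x, |birkhoffCocycle α φ n x| < ε := by
  obtain ⟨q, hq, hq1, hq2⟩ := hR ε hε 1
  obtain ⟨β, hβ, hβ'⟩ := AddCircle.exists_coe_eq_abs_eq_norm ((q : ℤ) • (α : AddCircle (1 : ℝ)))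
  refine ⟨q, β, ?_, hβ' ▸ hq1, hβ, hq2⟩
  rw [hβ', norm_pos_iff, ← AddCircle.coe_zsmul, Ne, AddCircle.coe_eq_zero_iff]
  rintro ⟨m, hm⟩
  have hqα : Irrational ((q : ℝ) * α) := hα.natCast_mul (by omega)
  exact hqα.ne_int m (by simpa using hm.symm)

theorem exists_small_translation_signed (hα : Irrational α) (hR : UniformlyRecurrent α φ)
    {ε : ℝ} (hε : 0 < ε) (τ : ℝ) :
    ∃ (n : ℤ) (β : ℝ), 0 < |β| ∧ |β| < ε ∧ 0 ≤ β * τ ∧ (β : AddCircle (1 : ℝ)) =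
      n • (α : AddCircle (1 : ℝ)) ∧ ∀ x, |birkhoffCocycle α φ n x| < ε := by
  obtain ⟨n, β, h0, h1, h2, h3⟩ := hR.exists_small_translation hα hε
  rcases le_total 0 (β * τ) with h | h
  · exact ⟨n, β, h0, h1, h, h2, h3⟩
  · refine ⟨-n, -β, by rwa [abs_neg], by rwa [abs_neg], by linarith, by simp [h2], fun x => ?_⟩
    rw [birkhoffCocycle_neg, abs_neg]
    exact h3 _

theorem exists_mem_orbitClosure_of_notMem_Lx (hα : Irrational α)
    (hR : UniformlyRecurrent α φ) {x : AddCircle (1 : ℝ)} {a : ℝ} (ha : 0 < a)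
    (h1 : a ∉ Lx α φ x) (h2 : -a ∉ Lx α φ x) :
    ∃ δ > 0, ∀ t, ‖t - x‖ < δ → ∃ y, |y| ≤ a ∧ (t, y) ∈ orbitClosure α φ x := by
  have hclosed : IsClosed (orbitClosure α φ x) := isClosed_closure
  rw [mem_Lx_iff_mem_orbitClosure hR] at h1 h2
  obtain ⟨δ₁, hδ₁, hb₁⟩ := Metric.isOpen_iff.1 hclosed.isOpen_compl _ h1
  obtain ⟨δ₂, hδ₂, hb₂⟩ := Metric.isOpen_iff.1 hclosed.isOpen_compl _ h2
  set δ := min δ₁ δ₂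
  have hδ : 0 < δ := lt_min hδ₁ hδ₂
  have hbar : ∀ t y, ‖t - x‖ < δ → (t, y) ∈ orbitClosure α φ x →
      ¬ |y - a| < δ ∧ ¬ |y + a| < δ := by
    intro t y ht hty
    refine ⟨fun h => hb₁ ?_ hty, fun h => hb₂ ?_ hty⟩
    · rw [Metric.mem_ball, Prod.dist_eq, max_lt_iff, dist_eq_norm, Real.dist_eq]
      exact ⟨ht.trans_le (min_le_left _ _), h.trans_le (min_le_left _ _)⟩
    · rw [Metric.mem_ball, Prod.dist_eq, max_lt_iff, dist_eq_norm, Real.dist_eq, sub_neg_eq_add]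
      exact ⟨ht.trans_le (min_le_right _ _), h.trans_le (min_le_right _ _)⟩
  refine ⟨δ, hδ, fun t ht => ?_⟩
  set K := orbitClosure α φ x ∩ (Set.univ ×ˢ Set.Icc (-a) a)
  have hK : IsCompact K := (isCompact_univ.prod isCompact_Icc).inter_left hclosed
  suffices hmem : t ∈ Prod.fst '' K by
    obtain ⟨⟨t', y⟩, ⟨hy1, hy2⟩, rfl⟩ := hmem
    exact ⟨y, abs_le.2 hy2.2, hy1⟩
  rw [← (hK.image continuous_fst).isClosed.closure_eq, Metric.mem_closure_iff]
  intro ε hε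
  obtain ⟨τ, hτ, hτ'⟩ := AddCircle.exists_coe_eq_abs_eq_norm (t - x)
  obtain ⟨n, β, hβ0, hβ, hβτ, hβn, hS⟩ :=
    exists_small_translation_signed hα hR (lt_min hε hδ) τ
  have horb : ∀ m : ℤ, (x + m • (α : AddCircle (1 : ℝ)), birkhoffCocycle α φ m x) ∈
      orbitClosure α φ x := fun m => subset_closure ⟨m, rfl⟩
  have hrot : ∀ i : ℕ, ((i : ℤ) * n) • (α : AddCircle (1 : ℝ)) =
      (((i : ℝ) * β : ℝ) : AddCircle (1 : ℝ)) := by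
    intro i
    rw [mul_smul, ← hβn, ← AddCircle.coe_zsmul]
    simp
  set j := ⌊|τ| / |β|⌋₊
  have hj1 : (j : ℝ) * |β| ≤ |τ| := (le_div_iff₀ hβ0).1 (Nat.floor_le (by positivity))
  have hj2 : |τ| < ((j : ℝ) + 1) * |β| := (div_lt_iff₀ hβ0).1 (Nat.lt_floor_add_one _)
  have htrap : ∀ i : ℕ, i ≤ j → |birkhoffCocycle α φ ((i : ℤ) * n) x| < a := by
    intro i
    induction i with
    | zero => simpa using ha
    | succ i ih =>
      intro hi
      have hprev := ih (by omega)
      have hnorm : ‖x + (((i + 1 : ℕ) : ℤ) * n) • (α : AddCircle (1 : ℝ)) - x‖ < δ := by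
        rw [add_sub_cancel_left, hrot]
        refine (AddCircle.norm_coe_le_abs _).trans_lt ?_
        rw [abs_mul, Nat.abs_cast]
        have : ((i + 1 : ℕ) : ℝ) ≤ j := by exact_mod_cast hi
        calc _ ≤ (j : ℝ) * |β| := by gcongr
          _ ≤ |τ| := hj1
          _ < δ := hτ' ▸ ht
      have hbarrier := hbar _ _ hnorm (horb _)
      have hstep : birkhoffCocycle α φ (((i + 1 : ℕ) : ℤ) * n) x =
          birkhoffCocycle α φ ((i : ℤ) * n) x + birkhoffCocycle α φ n
            (x + ((i : ℤ) * n) • (α : AddCircle (1 : ℝ))) := by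
        rw [← birkhoffCocycle_add]; push_cast; ring_nf
      have hinc := (hS (x + ((i : ℤ) * n) • (α : AddCircle (1 : ℝ)))).trans_le (min_le_right _ _)
      rw [hstep] at hbarrier ⊢
      simp only [abs_lt, not_and_or, not_lt] at *
      constructor
      · by_contra hlt
        rcases hbarrier.2 with h | h <;> linarith [hinc.1, hinc.2, hprev.1, hprev.2]
      · by_contra hlt
        rcases hbarrier.1 with h | h <;> linarith [hinc.1, hinc.2, hprev.1, hprev.2]
  refine ⟨_, ⟨_, ⟨horb ((j : ℤ) * n), Set.mem_univ _, ?_⟩, rfl⟩, ?_⟩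
  · exact abs_le.1 (htrap j le_rfl).le
  · rw [dist_eq_norm, ← sub_sub, ← hτ, hrot, ← AddCircle.coe_sub]
    refine (AddCircle.norm_coe_le_abs _).trans_lt ?_
    refine lt_of_lt_of_le ?_ (min_le_left ε δ)
    refine lt_trans ?_ hβ
    rw [abs_lt]
    rcases abs_cases τ with ⟨e1, _⟩ | ⟨e1, _⟩ <;> rcases abs_cases β with ⟨e2, _⟩ | ⟨e2, _⟩ <;>
      rw [e1, e2] at hj1 hj2 <;> rw [e2] at * <;> constructor <;> nlinarith

theorem exists_mem_Lx_near_neg (hα : Irrational α) (hφ : Continuous φ)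
    (hR : UniformlyRecurrent α φ) {x : AddCircle (1 : ℝ)} {a : ℝ} (ha : 0 < a)
    (h1 : a ∉ Lx α φ x) (h2 : -a ∉ Lx α φ x) :
    ∃ δ > 0, ∀ n : ℤ, ‖n • (α : AddCircle (1 : ℝ))‖ < δ →
      ∃ y ∈ Lx α φ x, |y + birkhoffCocycle α φ n x| ≤ a := by
  obtain ⟨δ, hδ, h⟩ := exists_mem_orbitClosure_of_notMem_Lx hα hR ha h1 h2
  refine ⟨δ, hδ, fun n hn => ?_⟩
  obtain ⟨y, hy, hmem⟩ := h (x + n • (α : AddCircle (1 : ℝ))) (by simpa using hn)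
  refine ⟨y - birkhoffCocycle α φ n x, ?_, by simpa using hy⟩
  rw [mem_Lx_iff_mem_orbitClosure hR]
  simpa [birkhoffCocycle_neg, ← sub_eq_add_neg] using orbitClosure_anzai_mem hφ hmem (-n)

theorem neg_mem_Lx_of_isolated (hα : Irrational α) (hφ : Continuous φ)
    (hR : UniformlyRecurrent α φ) {x : AddCircle (1 : ℝ)} {a₀ : ℝ} (ha₀ : 0 < a₀)
    (hiso : ∀ a, 0 < a → a < a₀ → a ∉ Lx α φ x ∧ -a ∉ Lx α φ x) {y : ℝ}
    (hy : y ∈ Lx α φ x) : -y ∈ Lx α φ x := by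
  rw [← (isClosed_Lx hR x).closure_eq, Metric.mem_closure_iff]
  intro ε hε
  have hpos : 0 < min (a₀ / 2) (ε / 2) := by positivity
  have hlt : min (a₀ / 2) (ε / 2) < a₀ := (min_le_left _ _).trans_lt (by linarith)
  obtain ⟨h1, h2⟩ := hiso _ hpos hlt
  obtain ⟨δ, hδ, h⟩ := exists_mem_Lx_near_neg hα hφ hR hpos h1 h2
  obtain ⟨n, hn1, hn2⟩ := (mem_Lx_iff hR).1 hy (min δ (ε / 2)) (by positivity)
  obtain ⟨z, hz, hzn⟩ := h n (hn1.trans_le (min_le_left _ _))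
  refine ⟨z, hz, ?_⟩
  replace hn2 := hn2.trans_le (min_le_right _ _)
  replace hzn := hzn.trans (min_le_right _ _)
  rw [Real.dist_eq]
  rw [abs_lt] at *
  rw [abs_le] at hzn
  constructor <;> linarith

end Structure

/-! ### Coboundaries modulo a period -/

section Coboundary

variable {α : ℝ} {φ : AddCircle (1 : ℝ) → ℝ}

theorem denseRange_add_zsmul (hα : Irrational α) (x : AddCircle (1 : ℝ)) :
    DenseRange fun n : ℤ => x + n • (α : AddCircle (1 : ℝ)) := by
  have h : DenseRange fun n : ℤ => n • (α : AddCircle (1 : ℝ)) :=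
    AddCircle.denseRange_zsmul_coe_iff.2 (by simpa using hα)
  exact (Homeomorph.addLeft x).surjective.denseRange.comp h (Homeomorph.addLeft x).continuous

/-- If the Birkhoff sums at `x` are small modulo `c` along the return times of the rotation, then
`φ` is a continuous coboundary modulo `c`. -/
theorem exists_coboundary_mod (hα : Irrational α) (hφ : Continuous φ)
    {c : ℝ} [Fact (0 < c)] {x : AddCircle (1 : ℝ)}
    (hsmall : ∀ ε > 0, ∃ δ > 0, ∀ n : ℤ, ‖n • (α : AddCircle (1 : ℝ))‖ < δ →
      ‖(birkhoffCocycle α φ n x : AddCircle c)‖ ≤ ε) :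
    ∃ h : AddCircle (1 : ℝ) → AddCircle c, Continuous h ∧
      ∀ t, h (t + (α : AddCircle (1 : ℝ))) = h t + (φ t : AddCircle c) := by
  set K : Set (AddCircle (1 : ℝ) × AddCircle c) := closure (Set.range fun n : ℤ =>
    (x + n • (α : AddCircle (1 : ℝ)), (birkhoffCocycle α φ n x : AddCircle c))) with hKdef
  have hKc : IsCompact K := isClosed_closure.isCompact
  have hinv : ∀ t w, (t, w) ∈ K → ∀ m : ℤ,
      (t + m • (α : AddCircle (1 : ℝ)), w + (birkhoffCocycle α φ m t : AddCircle c)) ∈ K := by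
    intro t w hw m
    have hc : Continuous fun w : AddCircle (1 : ℝ) × AddCircle c =>
        (w.1 + m • (α : AddCircle (1 : ℝ)),
          w.2 + (birkhoffCocycle α φ m w.1 : AddCircle c)) := by
      have h1 := continuous_birkhoffCocycle (α := α) hφ m
      have h2 : Continuous ((↑) : ℝ → AddCircle c) := AddCircle.continuous_mk' c
      exact (by fun_prop : Continuous fun w : AddCircle (1 : ℝ) × AddCircle c =>
        w.1 + m • (α : AddCircle (1 : ℝ))).prodMk
          (continuous_snd.add (h2.comp (h1.comp continuous_fst)))
    refine map_mem_closure (x := (t, w)) hc hw ?_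
    rintro _ ⟨n, rfl⟩
    refine ⟨n + m, ?_⟩
    simp only [birkhoffCocycle_add, add_smul, add_assoc, AddCircle.coe_add]
  have hfib : ∀ w, (x, w) ∈ K → w = 0 := by
    intro w hw
    rw [← norm_le_zero_iff]
    refine le_of_forall_pos_le_add fun ε hε => ?_
    obtain ⟨δ, hδ, h⟩ := hsmall (ε / 2) (half_pos hε)
    obtain ⟨n, hn⟩ := Metric.mem_closure_range_iff.1 hw (min δ (ε / 2)) (by positivity)
    rw [dist_comm, Prod.dist_eq, max_lt_iff, dist_eq_norm, dist_comm, dist_eq_norm] at hn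
    have h1 := h n (by simpa using hn.1.trans_le (min_le_left _ _))
    have h2 := hn.2.trans_le (min_le_right _ _)
    have h3 := norm_le_norm_add_norm_sub' w (birkhoffCocycle α φ n x : AddCircle c)
    linarith
  have hex : ∀ t, ∃ w, (t, w) ∈ K := by
    intro t
    have hcl := (hKc.image continuous_fst).isClosed
    have : t ∈ Prod.fst '' K := by
      rw [← hcl.closure_eq]
      refine closure_mono ?_ (denseRange_add_zsmul hα x t)
      rintro _ ⟨n, rfl⟩
      exact ⟨_, subset_closure ⟨n, rfl⟩, rfl⟩
    obtain ⟨⟨_, w⟩, hw, rfl⟩ := this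
    exact ⟨w, hw⟩
  have huniq : ∀ t w₁ w₂, (t, w₁) ∈ K → (t, w₂) ∈ K → w₁ = w₂ := by
    intro t w₁ w₂ h₁ h₂
    set K₂ : Set (AddCircle (1 : ℝ) × AddCircle c × AddCircle c) :=
      {z | (z.1, z.2.1) ∈ K ∧ (z.1, z.2.2) ∈ K ∧ z.2.1 - z.2.2 = w₁ - w₂}
    have hK₂ : IsClosed K₂ := by
      have hK : IsClosed K := isClosed_closure
      exact (hK.preimage (by fun_prop)).inter ((hK.preimage (by fun_prop)).inter
        (isClosed_eq (by fun_prop) continuous_const))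
    have hcl := (hK₂.isCompact.image continuous_fst).isClosed
    have hmem : x ∈ Prod.fst '' K₂ := by
      rw [← hcl.closure_eq]
      refine closure_mono ?_ (denseRange_add_zsmul hα t x)
      rintro _ ⟨n, rfl⟩
      exact ⟨(_, _, _), ⟨hinv t w₁ h₁ n, hinv t w₂ h₂ n, by simp⟩, rfl⟩
    obtain ⟨⟨_, v₁, v₂⟩, ⟨hv₁, hv₂, hv⟩, rfl⟩ := hmem
    have e₁ := hfib _ hv₁
    have e₂ := hfib _ hv₂
    simp only at e₁ e₂ hv
    rw [e₁, e₂, sub_zero] at hv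
    exact (sub_eq_zero.1 hv.symm)
  choose h hh using hex
  refine ⟨h, ?_, fun t => ?_⟩
  · rw [continuous_iff_isClosed]
    intro V hV
    have : h ⁻¹' V = Prod.fst '' (K ∩ Prod.snd ⁻¹' V) := by
      ext t
      constructor
      · exact fun ht => ⟨(t, h t), ⟨hh t, ht⟩, rfl⟩
      · rintro ⟨⟨t, w⟩, ⟨h1, h2⟩, rfl⟩
        rw [Set.mem_preimage, huniq _ _ _ (hh t) h1]
        exact h2
    rw [this]
    exact ((hKc.inter_right (hV.preimage continuous_snd)).image continuous_fst).isClosed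
  · have := hinv t (h t) (hh t) 1
    rw [one_smul, birkhoffCocycle_one] at this
    exact huniq _ _ _ (hh _) this

/-- A continuous real function with values in `ℤ c` is constant. -/
theorem exists_int_mul_of_coe_eq_zero {c : ℝ} {f : ℝ → ℝ} (hf : Continuous f)
    (h : ∀ t, (f t : AddCircle c) = 0) : ∃ m : ℤ, ∀ t, f t = m * c := by
  have hcov := AddCircle.isCoveringMap_coe c
  obtain ⟨m, hm⟩ := (AddCircle.coe_eq_zero_iff c).1 (h 0)
  refine ⟨m, fun t => ?_⟩
  have hconst := hcov.eq_of_comp_eq hf (continuous_const (y := f 0))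
    (funext fun t => by simp [h]) 0 rfl
  rw [congrFun hconst t, ← hm, zsmul_eq_mul]

/-- A continuous coboundary modulo `c` with uniformly recurrent Birkhoff sums is a continuous
coboundary. -/
theorem exists_coboundary_of_mod (hα : Irrational α) (hφ : Continuous φ)
    (hR : UniformlyRecurrent α φ) {c : ℝ} [Fact (0 < c)]
    {h : AddCircle (1 : ℝ) → AddCircle c} (hh : Continuous h)
    (heq : ∀ t, h (t + (α : AddCircle (1 : ℝ))) = h t + (φ t : AddCircle c)) :
    ∃ u : AddCircle (1 : ℝ) → ℝ, Continuous u ∧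
      ∀ t, u (t + (α : AddCircle (1 : ℝ))) - u t = φ t := by
  have hc : 0 < c := Fact.out
  have hmk : Continuous ((↑) : ℝ → AddCircle (1 : ℝ)) := AddCircle.continuous_mk' 1
  obtain ⟨e, he⟩ := QuotientAddGroup.mk_surjective (h ((0 : ℝ) : AddCircle (1 : ℝ)))
  obtain ⟨H, ⟨-, hH⟩, -⟩ := (AddCircle.isCoveringMap_coe c).existsUnique_continuousMap_lifts
    ⟨fun t : ℝ => h t, hh.comp hmk⟩ 0 e he
  have hH' : ∀ t : ℝ, (H t : AddCircle c) = h t := fun t => congrFun hH t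
  have hHc : Continuous H := H.continuous
  obtain ⟨d, hd⟩ := exists_int_mul_of_coe_eq_zero (c := c) (f := fun t => H (t + 1) - H t)
    (by fun_prop) (fun t => by
      rw [AddCircle.coe_sub, hH', hH', AddCircle.coe_add_period, sub_self])
  obtain ⟨m, hm⟩ := exists_int_mul_of_coe_eq_zero (c := c)
    (f := fun t : ℝ => H (t + α) - H t - φ (t : AddCircle (1 : ℝ)))
    ((by fun_prop : Continuous fun t => H (t + α) - H t).sub (hφ.comp hmk)) (fun t => by
      rw [AddCircle.coe_sub, AddCircle.coe_sub, hH', hH', AddCircle.coe_add, heq]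
      abel)
  -- the periodic part of the lift is bounded
  have hper : Function.Periodic (fun t => H t - d * c * t) 1 := by
    intro t
    simp only
    linarith [hd t]
  obtain ⟨B, hB⟩ : ∃ B, ∀ t, |H t - d * c * t| ≤ B := by
    obtain ⟨B, hB⟩ := (isCompact_Icc (a := (0 : ℝ)) (b := 1)).exists_bound_of_continuousOn
      (f := fun t => H t - d * c * t) (by fun_prop : Continuous _).continuousOn
    refine ⟨B, fun t => ?_⟩
    obtain ⟨s, hs, hs'⟩ := hper.exists_mem_Ico₀ one_pos t
    have := hB s ⟨hs.1, hs.2.le⟩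
    rw [Real.norm_eq_abs, ← hs'] at this
    exact this
  have hiter : ∀ q : ℕ, H (q * α) = H 0 + birkhoffCocycle α φ q 0 + q * (m * c) := by
    intro q
    induction q with
    | zero => simp
    | succ q ih =>
      have h1 := hm (q * α)
      push_cast
      rw [birkhoffCocycle_add, birkhoffCocycle_one]
      have h2 : (0 : AddCircle (1 : ℝ)) + (q : ℤ) • (α : AddCircle (1 : ℝ)) =
          ((q * α : ℝ) : AddCircle (1 : ℝ)) := by
        rw [zero_add, ← AddCircle.coe_zsmul]; simp
      rw [h2, add_mul, one_mul]
      linarith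
  have hslope : (d : ℝ) * c * α - m * c = 0 := by
    by_contra hne
    have hpos := abs_pos.2 hne
    obtain ⟨N, hN⟩ := exists_nat_gt ((2 * B + 1) / |d * c * α - m * c|)
    obtain ⟨q, hqN, -, hq⟩ := hR 1 one_pos N
    have h1 := hB (q * α)
    have h2 := hB 0
    have h3 := hq 0
    rw [hiter q] at h1
    have h4 : (2 * B + 1) < q * |d * c * α - m * c| := by
      rw [div_lt_iff₀ hpos] at hN
      have : (N : ℝ) ≤ q := by exact_mod_cast hqN
      nlinarith
    have h5 : q * |d * c * α - m * c| = |(q : ℝ) * (d * c * α - m * c)| := by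
      rw [abs_mul, Nat.abs_cast]
    rw [h5, lt_abs] at h4
    rw [abs_le] at h1 h2
    rw [abs_lt] at h3
    rcases h4 with h4 | h4 <;> linarith [h1.1, h1.2, h2.1, h2.2, h3.1, h3.2]
  have hdm : (d : ℝ) * α = m := by
    have : c * ((d : ℝ) * α - m) = 0 := by linarith
    rcases mul_eq_zero.1 this with h | h <;> linarith
  have hd0 : d = 0 := by
    by_contra hd0
    exact (hα.intCast_mul hd0).ne_int m hdm
  have hm0 : m = 0 := by
    rw [hd0] at hdm
    exact_mod_cast (by simpa using hdm.symm : (m : ℝ) = 0)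
  have hHper : Function.Periodic H 1 := fun t => by
    have := hd t
    rw [hd0] at this
    simp only [Int.cast_zero, zero_mul] at this
    linarith
  refine ⟨hHper.lift, ?_, fun t => ?_⟩
  · exact continuous_coinduced_dom.2 hHc
  · induction t using QuotientAddGroup.induction_on with
    | H t =>
      have := hm t
      rw [hm0] at this
      simp only [Int.cast_zero, zero_mul] at this
      have h1 : hHper.lift ((t : AddCircle (1 : ℝ)) + (α : AddCircle (1 : ℝ))) = H (t + α) := by
        rw [← AddCircle.coe_add]; exact hHper.lift_coe _
      have h2 : hHper.lift (t : AddCircle (1 : ℝ)) = H t := hHper.lift_coe _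
      exact (congrArg₂ (· - ·) h1 h2).trans (by linarith)

end Coboundary

/-! ### The trichotomy -/

section Trichotomy

variable {α : ℝ} {φ : AddCircle (1 : ℝ) → ℝ}

theorem exists_subset_zmultiples_of_isClosed {L : AddSubgroup ℝ} (hL : IsClosed (L : Set ℝ))
    (hne : (L : Set ℝ) ≠ Set.univ) : ∃ c > 0, L ≤ AddSubgroup.zmultiples c := by
  rcases L.dense_or_cyclic with h | ⟨c, hc⟩
  · exact absurd (hL.closure_eq ▸ h.closure_eq) hne
  · rw [← AddSubgroup.zmultiples_eq_closure] at hc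
    rcases lt_trichotomy c 0 with h | rfl | h
    · refine ⟨-c, by linarith, ?_⟩
      rw [AddSubgroup.zmultiples_neg, hc]
    · exact ⟨1, one_pos, by simp [hc]⟩
    · exact ⟨c, h, hc.le⟩

theorem Ici_subset_Lx_or_Iic_subset_Lx (hα : Irrational α) (hφ : Continuous φ)
    (hR : UniformlyRecurrent α φ)
    (hcob : ¬ ∃ u : AddCircle (1 : ℝ) → ℝ, Continuous u ∧
      ∀ t, u (t + (α : AddCircle (1 : ℝ))) - u t = φ t) (x : AddCircle (1 : ℝ)) :
    Set.Ici 0 ⊆ Lx α φ x ∨ Set.Iic 0 ⊆ Lx α φ x := by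
  by_contra hcon
  rw [not_or] at hcon
  obtain ⟨hpos, hneg⟩ := hcon
  have hcl := isClosed_Lx hR x
  obtain ⟨a₁, ha₁, hp⟩ : ∃ a₁ > 0, ∀ y, 0 < y → y < a₁ → y ∉ Lx α φ x := by
    by_contra! hall
    refine hpos (Ici_subset_of_arbitrarily_small hcl
      (fun y hy k => nsmul_mem_Lx hφ hR hy k) fun ε hε => ?_)
    obtain ⟨y, h1, h2, h3⟩ := hall ε hε
    exact ⟨y, h3, h1, h2⟩
  obtain ⟨a₂, ha₂, hn⟩ : ∃ a₂ > 0, ∀ y, 0 < y → y < a₂ → -y ∉ Lx α φ x := by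
    by_contra! hall
    have hsub := Ici_subset_of_arbitrarily_small (L := Neg.neg ⁻¹' Lx α φ x)
      (hcl.preimage continuous_neg)
      (fun y hy k => by simpa using nsmul_mem_Lx hφ hR hy k) fun ε hε => by
        obtain ⟨y, h1, h2, h3⟩ := hall ε hε
        exact ⟨y, h3, h1, h2⟩
    refine hneg fun y hy => ?_
    simpa using hsub (show -y ∈ Set.Ici 0 by simpa using hy)
  have hiso : ∀ a, 0 < a → a < min a₁ a₂ → a ∉ Lx α φ x ∧ -a ∉ Lx α φ x := fun a h1 h2 =>
    ⟨hp a h1 (h2.trans_le (min_le_left _ _)), hn a h1 (h2.trans_le (min_le_right _ _))⟩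
  have hmin : 0 < min a₁ a₂ := lt_min ha₁ ha₂
  let L : AddSubgroup ℝ :=
    { carrier := Lx α φ x
      zero_mem' := zero_mem_Lx hR x
      add_mem' := add_mem_Lx hφ hR
      neg_mem' := neg_mem_Lx_of_isolated hα hφ hR hmin hiso }
  obtain ⟨c, hc, hLc⟩ := exists_subset_zmultiples_of_isClosed (L := L) hcl
    (fun h => hpos (by rw [show Lx α φ x = Set.univ from h]; exact Set.subset_univ _))
  have : Fact (0 < c) := ⟨hc⟩
  obtain ⟨h, hh, heq⟩ := exists_coboundary_mod (c := c) (x := x) hα hφ (by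
    intro ε hε
    have hpos' : 0 < min ε (min a₁ a₂ / 2) := by positivity
    obtain ⟨h1, h2⟩ := hiso _ hpos' ((min_le_right _ _).trans_lt (by linarith))
    obtain ⟨δ, hδ, hd⟩ := exists_mem_Lx_near_neg hα hφ hR hpos' h1 h2
    refine ⟨δ, hδ, fun n hn => ?_⟩
    obtain ⟨y, hy, hyn⟩ := hd n hn
    have hy0 : (y : AddCircle c) = 0 := (QuotientAddGroup.eq_zero_iff _).2 (hLc hy)
    have : (birkhoffCocycle α φ n x : AddCircle c) =
        ((y + birkhoffCocycle α φ n x : ℝ) : AddCircle c) := by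
      rw [AddCircle.coe_add, hy0, zero_add]
    rw [this]
    exact (QuotientAddGroup.norm_mk_le_norm.trans hyn).trans (min_le_left _ _))
  exact hcob (exists_coboundary_of_mod hα hφ hR hh heq)

/-- There is a point whose two-sided Birkhoff sums are bounded below; with `σ = -1`, above. -/
theorem exists_forall_neg_one_le_mul_birkhoffCocycle (hφ : Continuous φ)
    (hR : UniformlyRecurrent α φ) {σ : ℝ} (hσ : |σ| ≤ 1) :
    ∃ x, ∀ n : ℤ, -1 ≤ σ * birkhoffCocycle α φ n x := by
  let E : ℕ → Set (AddCircle (1 : ℝ)) := fun N =>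
    {x | ∀ n : ℤ, |n| ≤ N → -1 ≤ σ * birkhoffCocycle α φ n x}
  have hclosed : ∀ N, IsClosed (E N) := by
    intro N
    simp only [E, Set.ofPred_forall]
    refine isClosed_iInter fun n => isClosed_iInter fun _ => isClosed_le continuous_const ?_
    exact continuous_const.mul (continuous_birkhoffCocycle hφ n)
  have hne : ∀ N, (E N).Nonempty := by
    intro N
    obtain ⟨q, hqN, -, hq⟩ := hR 1 one_pos (N + 1)
    have hq' : ∀ x, |σ * birkhoffCocycle α φ q x| ≤ 1 := fun x => by
      rw [abs_mul]
      exact mul_le_one₀ hσ (abs_nonneg _) (hq x).le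
    obtain ⟨m, hm, hmin⟩ := Finset.exists_min_image (Finset.range (q + 1))
      (fun m : ℕ => σ * birkhoffCocycle α φ m 0) ⟨0, by simp⟩
    rw [Finset.mem_range] at hm
    set x : AddCircle (1 : ℝ) := 0 + (m : ℤ) • (α : AddCircle (1 : ℝ))
    have hwin : ∀ n : ℤ, -(m : ℤ) ≤ n → n ≤ q - m → 0 ≤ σ * birkhoffCocycle α φ n x := by
      intro n h1 h2
      obtain ⟨k, hk⟩ := Int.eq_ofNat_of_zero_le (show 0 ≤ (m : ℤ) + n by omega)
      have h3 := hmin k (by rw [Finset.mem_range]; omega)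
      have h4 := birkhoffCocycle_add (α := α) (φ := φ) m n 0
      rw [hk] at h4
      rw [h4, mul_add] at h3
      linarith
    refine ⟨x, fun n hn => ?_⟩
    rw [abs_le] at hn
    rcases lt_or_ge n (-(m : ℤ)) with h | h
    · have h1 := hwin (n + q) (by omega) (by omega)
      rw [birkhoffCocycle_add, mul_add] at h1
      have h2 := (abs_le.1 (hq' (x + n • (α : AddCircle (1 : ℝ))))).2
      linarith
    · rcases le_or_gt n (q - m) with h' | h'
      · linarith [hwin n h h']
      · have h1 := hwin (n - q) (by omega) (by omega)
        have h2 := (abs_le.1 (hq' (x + (n - q) • (α : AddCircle (1 : ℝ))))).1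
        have h3 := birkhoffCocycle_add (α := α) (φ := φ) (n - q) q x
        rw [sub_add_cancel] at h3
        rw [h3, mul_add]
        linarith
  obtain ⟨x, hx⟩ := IsCompact.nonempty_iInter_of_sequence_nonempty_isCompact_isClosed E
    (fun N x hx n hn => hx n (hn.trans (by push_cast; omega))) hne (hclosed 0).isCompact hclosed
  refine ⟨x, fun n => Set.mem_iInter.1 hx n.natAbs n (by simp)⟩

theorem exists_forall_mem_Lx_mul_nonneg (hφ : Continuous φ) (hR : UniformlyRecurrent α φ)
    {σ : ℝ} (hσ : |σ| ≤ 1) : ∃ x, ∀ y ∈ Lx α φ x, 0 ≤ σ * y := by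
  obtain ⟨x, hx⟩ := exists_forall_neg_one_le_mul_birkhoffCocycle hφ hR hσ
  have hbd : ∀ y ∈ Lx α φ x, -2 ≤ σ * y := by
    intro y hy
    obtain ⟨n, -, hn⟩ := (mem_Lx_iff hR).1 hy 1 one_pos
    have h1 := hx n
    have h2 : |σ * (birkhoffCocycle α φ n x - y)| ≤ 1 := by
      rw [abs_mul]
      exact mul_le_one₀ hσ (abs_nonneg _) hn.le
    rw [abs_le] at h2
    nlinarith [h2.1, h2.2]
  refine ⟨x, fun y hy => ?_⟩
  by_contra! hlt
  obtain ⟨k, hk⟩ := exists_nat_gt (2 / -(σ * y))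
  rw [div_lt_iff₀ (by linarith)] at hk
  have := hbd _ (nsmul_mem_Lx hφ hR hy k)
  nlinarith

theorem isGδ_setOf_mem_Lx (hφ : Continuous φ) (hR : UniformlyRecurrent α φ) (y : ℝ) :
    IsGδ {x | y ∈ Lx α φ x} := by
  have : {x | y ∈ Lx α φ x} = ⋂ k : ℕ, {x | ∃ n : ℤ,
      ‖n • (α : AddCircle (1 : ℝ))‖ < 1 / ((k : ℝ) + 1) ∧
        |birkhoffCocycle α φ n x - y| < 1 / ((k : ℝ) + 1)} := by
    ext x
    simp only [Set.mem_ofPred_eq, Set.mem_iInter, mem_Lx_iff hR]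
    constructor
    · exact fun h k => h _ (by positivity)
    · intro h ε hε
      obtain ⟨k, hk⟩ := exists_nat_one_div_lt hε
      obtain ⟨n, h1, h2⟩ := h k
      exact ⟨n, h1.trans hk, h2.trans hk⟩
  rw [this]
  refine IsGδ.iInter_of_isOpen fun k => ?_
  simp only [Set.ofPred_exists]
  refine isOpen_iUnion fun n => ?_
  have := continuous_birkhoffCocycle (α := α) hφ n
  exact IsOpen.and isOpen_const (isOpen_lt (by fun_prop) continuous_const)

theorem dense_setOf_mem_Lx (hα : Irrational α) (hφ : Continuous φ)
    (hR : UniformlyRecurrent α φ) {x : AddCircle (1 : ℝ)} {y : ℝ} (hy : y ∈ Lx α φ x) :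
    Dense {x | y ∈ Lx α φ x} := by
  refine (denseRange_add_zsmul hα x).mono ?_
  rintro _ ⟨n, rfl⟩
  exact Lx_subset_Lx_add hφ hR x n hy

/-- The trichotomy for uniformly recurrent skew products that are not coboundaries. -/
theorem trichotomy_of_uniformlyRecurrent (hα : Irrational α) (hφ : Continuous φ)
    (hR : UniformlyRecurrent α φ)
    (hcob : ¬ ∃ u : AddCircle (1 : ℝ) → ℝ, Continuous u ∧
      ∀ t, u (t + (α : AddCircle (1 : ℝ))) - u t = φ t) :
    let D : Set (AddCircle (1 : ℝ)) := {x | Lx α φ x = Set.univ}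
    let P : Set (AddCircle (1 : ℝ)) := {x | Lx α φ x = Set.Ici 0}
    let N : Set (AddCircle (1 : ℝ)) := {x | Lx α φ x = Set.Iic 0}
    D.Nonempty ∧ P.Nonempty ∧ N.Nonempty ∧
      Disjoint D P ∧ Disjoint D N ∧ Disjoint P N ∧
      MeasurableSet D ∧ MeasurableSet P ∧ MeasurableSet N ∧
      D ∪ P ∪ N = Set.univ := by
  intro D P N
  have hor := Ici_subset_Lx_or_Iic_subset_Lx hα hφ hR hcob
  have hposray : ∀ x y, 0 < y → y ∈ Lx α φ x → Set.Ici 0 ⊆ Lx α φ x := by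
    intro x y hy hyL
    rcases hor x with h | h
    · exact h
    · intro z hz
      obtain ⟨k, hk⟩ := exists_nat_gt (z / y)
      rw [div_lt_iff₀ hy] at hk
      have := add_mem_Lx hφ hR (nsmul_mem_Lx hφ hR hyL k)
        (h (show z - k * y ∈ Set.Iic 0 from by simpa using hk.le))
      simpa using this
  have hnegray : ∀ x y, y < 0 → y ∈ Lx α φ x → Set.Iic 0 ⊆ Lx α φ x := by
    intro x y hy hyL
    rcases hor x with h | h
    · intro z hz
      obtain ⟨k, hk⟩ := exists_nat_gt (z / y)
      rw [div_lt_iff_of_neg hy] at hk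
      have := add_mem_Lx hφ hR (nsmul_mem_Lx hφ hR hyL k)
        (h (show z - k * y ∈ Set.Ici 0 from by simpa using hk.le))
      simpa using this
    · exact h
  have hD : D = {x | 1 ∈ Lx α φ x} ∩ {x | -1 ∈ Lx α φ x} := by
    ext x
    simp only [D, Set.mem_ofPred_eq, Set.mem_inter_iff]
    refine ⟨fun h => by simp [h], fun ⟨h1, h2⟩ => Set.eq_univ_of_forall fun y => ?_⟩
    rcases le_total 0 y with hy | hy
    · exact hposray x 1 one_pos h1 hy
    · exact hnegray x (-1) (by norm_num) h2 hy
  have hP : P = {x | 1 ∈ Lx α φ x} ∩ {x | -1 ∈ Lx α φ x}ᶜ := by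
    ext x
    simp only [P, Set.mem_ofPred_eq, Set.mem_inter_iff, Set.mem_compl_iff]
    refine ⟨fun h => by norm_num [h], fun ⟨h1, h2⟩ =>
      Set.Subset.antisymm (fun y hy => ?_) (hposray x 1 one_pos h1)⟩
    by_contra hy0
    exact h2 (hnegray x y (by simpa using hy0) hy (by simp))
  have hN : N = {x | -1 ∈ Lx α φ x} ∩ {x | 1 ∈ Lx α φ x}ᶜ := by
    ext x
    simp only [N, Set.mem_ofPred_eq, Set.mem_inter_iff, Set.mem_compl_iff]
    refine ⟨fun h => by norm_num [h], fun ⟨h1, h2⟩ =>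
      Set.Subset.antisymm (fun y hy => ?_) (hnegray x (-1) (by norm_num) h1)⟩
    by_contra hy0
    exact h2 (hposray x y (by simpa using hy0) hy (by simp))
  have hm1 := (isGδ_setOf_mem_Lx hφ hR (α := α) 1).measurableSet
  have hm2 := (isGδ_setOf_mem_Lx hφ hR (α := α) (-1)).measurableSet
  have hcover : ∀ x, 1 ∈ Lx α φ x ∨ -1 ∈ Lx α φ x := fun x =>
    (hor x).imp (fun h => h (by simp)) (fun h => h (by simp))
  obtain ⟨xp, hxp⟩ := exists_forall_mem_Lx_mul_nonneg hφ hR (α := α) (σ := 1) (by simp)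
  obtain ⟨xn, hxn⟩ := exists_forall_mem_Lx_mul_nonneg hφ hR (α := α) (σ := -1) (by simp)
  have hxp' : xp ∈ P := by
    have h2 : -1 ∉ Lx α φ xp := fun h => by norm_num at hxp; linarith [hxp _ h]
    rw [hP]
    exact ⟨(hcover xp).resolve_right h2, h2⟩
  have hxn' : xn ∈ N := by
    have h2 : 1 ∉ Lx α φ xn := fun h => by have := hxn _ h; norm_num at this
    rw [hN]
    exact ⟨(hcover xn).resolve_left h2, h2⟩
  refine ⟨?_, ⟨xp, hxp'⟩, ⟨xn, hxn'⟩, ?_, ?_, ?_, ?_, ?_, ?_, ?_⟩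
  · rw [hD]
    rw [hP] at hxp'
    rw [hN] at hxn'
    exact (Dense.inter_of_Gδ (isGδ_setOf_mem_Lx hφ hR 1) (isGδ_setOf_mem_Lx hφ hR (-1))
      (dense_setOf_mem_Lx hα hφ hR hxp'.1) (dense_setOf_mem_Lx hα hφ hR hxn'.1)).nonempty
  · rw [hD, hP, Set.disjoint_left]; exact fun x h1 h2 => h2.2 h1.2
  · rw [hD, hN, Set.disjoint_left]; exact fun x h1 h2 => h2.2 h1.1
  · rw [hP, hN, Set.disjoint_left]; exact fun x h1 h2 => h1.2 h2.1
  · rw [hD]; exact hm1.inter hm2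
  · rw [hP]; exact hm1.inter hm2.compl
  · rw [hN]; exact hm2.inter hm1.compl
  · rw [hD, hP, hN]
    ext x
    have := hcover x
    simp only [Set.mem_union, Set.mem_inter_iff, Set.mem_ofPred_eq, Set.mem_compl_iff,
      Set.mem_univ, iff_true]
    tauto

end Trichotomy

/-! ### The sawtooth function and its Birkhoff sums -/

section Sawtooth

theorem sum_range_fract_add_div_periodic {q : ℕ} (hq : 0 < q) :
    Function.Periodic (fun s : ℝ => ∑ j ∈ Finset.range q, Int.fract (s + j / q)) (1 / q) := by
  intro s
  have hq' : (q : ℝ) ≠ 0 := by positivity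
  have h1 := Finset.sum_range_succ (fun j : ℕ => Int.fract (s + (j : ℝ) / q)) q
  have h2 := Finset.sum_range_succ' (fun j : ℕ => Int.fract (s + (j : ℝ) / q)) q
  have h3 : ∀ j : ℕ, s + ((j + 1 : ℕ) : ℝ) / q = s + 1 / q + j / q := fun j => by
    push_cast; ring
  simp only [h3, Nat.cast_zero, zero_div, add_zero, div_self hq', Int.fract_add_one] at h1 h2
  linarith

theorem abs_sum_range_fract_add_div_sub_le {q : ℕ} (hq : 0 < q) (s : ℝ) :
    |∑ j ∈ Finset.range q, Int.fract (s + j / q) - q / 2| ≤ 1 / 2 := by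
  have hq' : (0 : ℝ) < q := by positivity
  have hs : s - (⌊s * q⌋ : ℝ) * (1 / q) = Int.fract (s * q) / q := by
    rw [Int.fract]; field_simp
  have hper := (sum_range_fract_add_div_periodic hq).sub_int_mul_eq ⌊s * q⌋ (x := s)
  rw [← hper, hs]
  have hfr0 := Int.fract_nonneg (s * q)
  have hfr1 := Int.fract_lt_one (s * q)
  have hterm : ∀ j ∈ Finset.range q, Int.fract (Int.fract (s * q) / q + (j : ℝ) / q) =
      Int.fract (s * q) / q + (j : ℝ) / q := by
    intro j hj
    rw [Int.fract_eq_self]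
    refine ⟨by positivity, ?_⟩
    rw [← add_div, div_lt_one hq']
    have : (j : ℝ) + 1 ≤ q := by exact_mod_cast Finset.mem_range.1 hj
    linarith
  rw [Finset.sum_congr rfl hterm, Finset.sum_add_distrib, Finset.sum_const, Finset.card_range,
    nsmul_eq_mul, mul_div_cancel₀ _ hq'.ne', ← Finset.sum_div]
  have hgauss : (∑ j ∈ Finset.range q, (j : ℝ)) = q * (q - 1) / 2 := by
    have := Finset.sum_range_id_mul_two q
    have h2 : ((∑ j ∈ Finset.range q, j : ℕ) : ℝ) * 2 = q * ((q - 1 : ℕ) : ℝ) := by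
      exact_mod_cast this
    rw [Nat.cast_sub hq] at h2
    push_cast at h2
    linarith
  rw [hgauss, mul_div_assoc, mul_div_cancel_left₀ _ hq'.ne', abs_le]
  constructor <;> linarith

theorem sum_range_fract_add_mul_div {q : ℕ} (hq : 0 < q) {p : ℤ} (hpq : IsCoprime p q) (s : ℝ) :
    ∑ i ∈ Finset.range q, Int.fract (s + i * (p / q)) =
      ∑ j ∈ Finset.range q, Int.fract (s + j / q) := by
  have hq' : (q : ℝ) ≠ 0 := by positivity
  have hqz : (q : ℤ) ≠ 0 := by omega
  have hmaps : Set.MapsTo (fun i : ℕ => (i * p % q).toNat) (Finset.range q : Set ℕ)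
      (Finset.range q) := by
    intro i _
    have h1 := Int.emod_nonneg (i * p) hqz
    have h2 := Int.emod_lt_of_pos (i * p) (show (0 : ℤ) < q by omega)
    simp only [Finset.coe_range, Set.mem_Iio]
    omega
  have hinj : Set.InjOn (fun i : ℕ => (i * p % q).toNat) (Finset.range q : Set ℕ) := by
    intro i hi k hk hik
    simp only [Finset.coe_range, Set.mem_Iio] at hi hk hik
    have h1 := Int.emod_nonneg (i * p) hqz
    have h2 := Int.emod_nonneg (k * p) hqz
    have h3 : (i * p : ℤ) % q = k * p % q := by omega
    have h4 : (q : ℤ) ∣ (k - i) * p := by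
      rw [sub_mul]; exact Int.ModEq.dvd h3
    have h5 : (q : ℤ) ∣ k - i := hpq.symm.dvd_of_dvd_mul_right h4
    have h6 := Int.eq_zero_of_abs_lt_dvd h5 (by rw [abs_lt]; omega)
    omega
  refine Finset.sum_nbij (fun i : ℕ => (i * p % q).toNat) hmaps hinj
    (Finset.surjOn_of_injOn_of_card_le _ hmaps hinj le_rfl) fun i _ => ?_
  rw [Int.fract_eq_fract]
  refine ⟨i * p / q, ?_⟩
  have h1 := Int.emod_nonneg (i * p) hqz
  have h2 : ((((i * p % q).toNat : ℕ) : ℤ) : ℝ) = ((i * p % q : ℤ) : ℝ) := by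
    rw [Int.toNat_of_nonneg h1]
  have h3 : ((i * p : ℤ) : ℝ) = ((q * (i * p / q) + i * p % q : ℤ) : ℝ) := by
    rw [Int.mul_ediv_add_emod]
  push_cast at h2 h3
  rw [h2]
  field_simp
  linarith

/-- The Denjoy–Koksma inequality for the sawtooth function. -/
theorem abs_sum_range_half_sub_fract_le {α : ℝ} {q : ℕ} (hq : 0 < q) {p : ℤ}
    (hpq : IsCoprime p q) (hαp : |α - p / q| ≤ 1 / (q : ℝ) ^ 2) (s : ℝ) :
    |∑ i ∈ Finset.range q, (1 / 2 - Int.fract (s + i * α))| ≤ 3 := by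
  have hq' : (0 : ℝ) < q := by positivity
  set F : ℝ → ℝ := fun s => ∑ i ∈ Finset.range q, Int.fract (s + i * (p / q)) with hF
  have hFeq : F = fun s : ℝ => ∑ j ∈ Finset.range q, Int.fract (s + (j : ℝ) / q) :=
    funext fun s => sum_range_fract_add_mul_div hq hpq s
  have hFper : Function.Periodic F (1 / q) := hFeq ▸ sum_range_fract_add_div_periodic hq
  have hFbd : |F s - q / 2| ≤ 1 / 2 := by
    rw [hFeq]; exact abs_sum_range_fract_add_div_sub_le hq s
  have hfloor : ∀ s, ∑ i ∈ Finset.range q, (⌊s + (i : ℝ) * (p / q)⌋ : ℝ) =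
      q * s + ∑ i ∈ Finset.range q, (i : ℝ) * (p / q) - F s := by
    intro s
    simp only [hF, Int.fract, Finset.sum_sub_distrib, Finset.sum_add_distrib, Finset.sum_const,
      Finset.card_range, nsmul_eq_mul]
    ring
  have hdiff : ∀ i ∈ Finset.range q, |(i : ℝ) * α - i * (p / q)| ≤ 1 / q := by
    intro i hi
    rw [← mul_sub, abs_mul, Nat.abs_cast]
    have : (i : ℝ) ≤ q := by exact_mod_cast (Finset.mem_range.1 hi).le
    calc (i : ℝ) * |α - p / q| ≤ q * (1 / (q : ℝ) ^ 2) := by gcongr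
      _ = 1 / q := by field_simp
  have hsumdiff : |∑ i ∈ Finset.range q, (i : ℝ) * α - ∑ i ∈ Finset.range q, (i : ℝ) * (p / q)|
      ≤ 1 := by
    rw [← Finset.sum_sub_distrib]
    refine (Finset.abs_sum_le_sum_abs _ _).trans ((Finset.sum_le_sum hdiff).trans ?_)
    simp [hq'.ne']
  have hup : ∑ i ∈ Finset.range q, (⌊s + (i : ℝ) * α⌋ : ℝ) ≤
      ∑ i ∈ Finset.range q, (⌊s + 1 / q + (i : ℝ) * (p / q)⌋ : ℝ) := by
    refine Finset.sum_le_sum fun i hi => ?_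
    have := (abs_le.1 (hdiff i hi)).2
    exact Int.cast_le.2 (Int.floor_mono (by linarith))
  have hlow : ∑ i ∈ Finset.range q, (⌊s - 1 / q + (i : ℝ) * (p / q)⌋ : ℝ) ≤
      ∑ i ∈ Finset.range q, (⌊s + (i : ℝ) * α⌋ : ℝ) := by
    refine Finset.sum_le_sum fun i hi => ?_
    have := (abs_le.1 (hdiff i hi)).1
    exact Int.cast_le.2 (Int.floor_mono (by linarith))
  rw [hfloor, hFper s, mul_add, mul_one_div_cancel hq'.ne'] at hup
  rw [hfloor, hFper.sub_eq, mul_sub, mul_one_div_cancel hq'.ne'] at hlow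
  have hmain : ∑ i ∈ Finset.range q, (1 / 2 - Int.fract (s + i * α)) =
      q / 2 - q * s - ∑ i ∈ Finset.range q, (i : ℝ) * α +
        ∑ i ∈ Finset.range q, (⌊s + (i : ℝ) * α⌋ : ℝ) := by
    simp only [Int.fract, Finset.sum_sub_distrib, Finset.sum_add_distrib, Finset.sum_const,
      Finset.card_range, nsmul_eq_mul]
    ring
  rw [hmain]
  rw [abs_le] at *
  constructor <;> linarith [hFbd.1, hFbd.2, hsumdiff.1, hsumdiff.2]

/-- Good rational approximations with large denominators. -/
theorem exists_rat_approx {α : ℝ} (hα : Irrational α) {ε : ℝ} (hε : 0 < ε) (N : ℕ) :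
    ∃ r : ℚ, N ≤ r.den ∧ |α - r| ≤ 1 / (r.den : ℝ) ^ 2 ∧ |r.den * α - r.num| < ε := by
  have hlow : ∃ η > 0, ∀ d ∈ Finset.Icc 1 N, η ≤ |(d : ℝ) * α - round (d * α)| := by
    rcases (Finset.Icc 1 N).eq_empty_or_nonempty with h | h
    · exact ⟨1, one_pos, by simp [h]⟩
    · obtain ⟨d, hd, hmin⟩ := Finset.exists_min_image (Finset.Icc 1 N)
        (fun d : ℕ => |(d : ℝ) * α - round (d * α)|) h
      refine ⟨_, abs_pos.2 (sub_ne_zero.2 ?_), hmin⟩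
      have : d ≠ 0 := by have := (Finset.mem_Icc.1 hd).1; omega
      exact (hα.natCast_mul this).ne_int _
  obtain ⟨η, hη, hηmin⟩ := hlow
  obtain ⟨n, hn⟩ := exists_nat_one_div_lt (lt_min hε hη)
  obtain ⟨r, hr, hrn⟩ := Real.exists_rat_abs_sub_le_and_den_le α (Nat.succ_pos n)
  have hden : (0 : ℝ) < r.den := by exact_mod_cast r.pos
  have hcast : (r : ℝ) = r.num / r.den := by
    exact_mod_cast (Rat.num_div_den r).symm
  have hsmall : |r.den * α - r.num| < min ε η := by
    have h1 : (r.den : ℝ) * α - r.num = r.den * (α - r) := by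
      rw [hcast]; field_simp
    rw [h1, abs_mul, Nat.abs_cast]
    refine lt_of_le_of_lt ?_ hn
    calc (r.den : ℝ) * |α - r| ≤ r.den * (1 / (((n.succ : ℕ) + 1) * r.den)) := by gcongr
      _ = 1 / ((n.succ : ℕ) + 1) := by field_simp
      _ ≤ 1 / ((n : ℝ) + 1) := by
        push_cast
        exact one_div_le_one_div_of_le (by positivity) (by linarith)
  refine ⟨r, ?_, ?_, hsmall.trans_le (min_le_left _ _)⟩
  · by_contra! hlt
    have h1 := hηmin r.den (Finset.mem_Icc.2 ⟨r.pos, hlt.le⟩)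
    have h2 := round_le ((r.den : ℝ) * α) r.num
    linarith [hsmall.trans_le (min_le_right _ _)]
  · refine hr.trans (one_div_le_one_div_of_le (by positivity) ?_)
    have : (r.den : ℝ) ≤ (n.succ : ℕ) := by exact_mod_cast hrn
    nlinarith

end Sawtooth

/-! ### Absolutely continuous cocycles are uniformly recurrent -/

section DenjoyKoksma

open AddCircle

/-- The sawtooth function `1/2 - {u}` on the circle. -/
def sawtooth (u : AddCircle (1 : ℝ)) : ℝ := 1 / 2 - (equivIco 1 0 u : ℝ)

theorem sawtooth_coe (s : ℝ) : sawtooth (s : AddCircle (1 : ℝ)) = 1 / 2 - Int.fract s := by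
  have := coe_equivIco_mk_apply (1 : ℝ) s
  rw [div_one, mul_one] at this
  rw [sawtooth]
  exact congrArg _ this

theorem measurable_sawtooth : Measurable sawtooth :=
  measurable_const.sub (measurable_subtype_coe.comp (measurableEquivIco 1 0).measurable)

theorem abs_sawtooth_le (u : AddCircle (1 : ℝ)) : |sawtooth u| ≤ 1 / 2 := by
  obtain ⟨s, rfl⟩ := QuotientAddGroup.mk_surjective u
  rw [sawtooth_coe, abs_le]
  constructor <;> linarith [Int.fract_nonneg s, Int.fract_lt_one s]

theorem haarAddCircle_one_eq_volume :
    (haarAddCircle : Measure (AddCircle (1 : ℝ))) = volume := by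
  rw [volume_eq_smul_haarAddCircle, ENNReal.ofReal_one, one_smul]

theorem sawtooth_sub_mul_integral {g : ℝ → ℝ} (hg : IntervalIntegrable g volume 0 1)
    {x : ℝ} (hx : x ∈ Set.Ico (0 : ℝ) 1) :
    ∫ t in (0 : ℝ)..1, sawtooth ((x - t : ℝ) : AddCircle (1 : ℝ)) * g t =
      (∫ t in (0 : ℝ)..1, t * g t) - (x + 1 / 2) * (∫ t in (0 : ℝ)..1, g t) +
        ∫ t in (0 : ℝ)..x, g t := by
  have hx0 := hx.1
  have hx1 := hx.2.le
  have hsub1 : Set.uIcc 0 x ⊆ Set.uIcc (0 : ℝ) 1 := by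
    rw [Set.uIcc_of_le hx0, Set.uIcc_of_le zero_le_one]; exact Set.Icc_subset_Icc_right hx1
  have hsub2 : Set.uIcc x 1 ⊆ Set.uIcc (0 : ℝ) 1 := by
    rw [Set.uIcc_of_le hx1, Set.uIcc_of_le zero_le_one]; exact Set.Icc_subset_Icc_left hx0
  have hg1 := hg.mono_set hsub1
  have hg2 := hg.mono_set hsub2
  have htg : IntervalIntegrable (fun t => t * g t) volume 0 1 :=
    hg.continuousOn_mul continuousOn_id
  have htg1 := htg.mono_set hsub1
  have htg2 := htg.mono_set hsub2
  have heq1 : Set.EqOn (fun t => t * g t - (x - 1 / 2) * g t)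
      (fun t => sawtooth ((x - t : ℝ) : AddCircle (1 : ℝ)) * g t) (Set.uIoc 0 x) := by
    intro t ht
    rw [Set.uIoc_of_le hx0] at ht
    have hf : Int.fract (x - t) = x - t :=
      Int.fract_eq_self.2 ⟨by linarith [ht.2], by linarith [ht.1, hx.2]⟩
    simp only [sawtooth_coe, hf]
    ring
  have heq2 : Set.EqOn (fun t => t * g t - (x + 1 / 2) * g t)
      (fun t => sawtooth ((x - t : ℝ) : AddCircle (1 : ℝ)) * g t) (Set.uIoc x 1) := by
    intro t ht
    rw [Set.uIoc_of_le hx1] at ht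
    have hf : Int.fract (x - t) = x - t + 1 := by
      rw [← Int.fract_add_one, Int.fract_eq_self]
      constructor <;> linarith [ht.1, ht.2, hx.1]
    simp only [sawtooth_coe, hf]
    ring
  have hi1 := (htg1.sub (hg1.const_mul (x - 1 / 2))).congr heq1
  have hi2 := (htg2.sub (hg2.const_mul (x + 1 / 2))).congr heq2
  rw [← intervalIntegral.integral_add_adjacent_intervals hi1 hi2,
    ← intervalIntegral.integral_congr_ae (ae_of_all _ fun t ht => heq1 ht),
    ← intervalIntegral.integral_congr_ae (ae_of_all _ fun t ht => heq2 ht),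
    intervalIntegral.integral_sub htg1 (hg1.const_mul _),
    intervalIntegral.integral_sub htg2 (hg2.const_mul _),
    intervalIntegral.integral_const_mul, intervalIntegral.integral_const_mul,
    ← intervalIntegral.integral_add_adjacent_intervals htg1 htg2,
    ← intervalIntegral.integral_add_adjacent_intervals hg1 hg2]
  ring

/-- An absolutely continuous function on the circle is, up to a constant, the convolution of
the sawtooth function with its derivative. -/
theorem AbsolutelyContinuous'.exists_eq_add_integral {φ : AddCircle (1 : ℝ) → ℝ}
    (hφ : AbsolutelyContinuous' φ) :
    ∃ (K : ℝ) (v : AddCircle (1 : ℝ) → ℝ), Integrable v ∧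
      ∀ x, φ x = K + ∫ t, sawtooth (x - t) * v t := by
  obtain ⟨g, hg, hφg⟩ := hφ
  have hgi : IntervalIntegrable g volume 0 1 :=
    (intervalIntegrable_iff_integrableOn_Ioc_of_le zero_le_one).2
      (hg.mono_set Set.Ioc_subset_Icc_self)
  have hg0 : ∫ t in (0 : ℝ)..1, g t = 0 := by
    rw [← hφg 1 (by simp), AddCircle.coe_period]
    simp
  refine ⟨φ ((0 : ℝ) : AddCircle (1 : ℝ)) - ∫ t in (0 : ℝ)..1, t * g t, liftIoc 1 0 g, ?_, ?_⟩
  · have hm : MemLp (fun t => (g t : ℂ)) 1 (volume.restrict (Set.Ioc (0 : ℝ) (0 + 1))) := by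
      rw [zero_add, memLp_one_iff_integrable]
      exact (hg.mono_set Set.Ioc_subset_Icc_self).ofReal
    exact (memLp_one_iff_integrable.1 hm.memLp_liftIoc).re
  · intro x
    obtain ⟨s, hs, rfl⟩ : ∃ s ∈ Set.Ico (0 : ℝ) 1, (s : AddCircle (1 : ℝ)) = x := by
      refine ⟨equivIco 1 0 x, ?_, (equivIco (1 : ℝ) 0).symm_apply_apply x⟩
      simpa using (equivIco (1 : ℝ) 0 x).2
    rw [← AddCircle.intervalIntegral_preimage 1 0, zero_add]
    have hcongr : ∫ t in (0 : ℝ)..1, sawtooth ((s : AddCircle (1 : ℝ)) - (t : AddCircle (1 : ℝ))) *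
          liftIoc 1 0 g (t : AddCircle (1 : ℝ)) =
        ∫ t in (0 : ℝ)..1, sawtooth ((s - t : ℝ) : AddCircle (1 : ℝ)) * g t := by
      refine intervalIntegral.integral_congr_ae (ae_of_all _ fun t ht => ?_)
      rw [Set.uIoc_of_le zero_le_one] at ht
      rw [liftIoc_zero_coe_apply ht, AddCircle.coe_sub]
    rw [hcongr, sawtooth_sub_mul_integral hgi hs, hg0, ← hφg s ⟨hs.1, hs.2.le⟩]
    ring

theorem integral_sawtooth : ∫ u, sawtooth u = 0 := by
  rw [← AddCircle.intervalIntegral_preimage 1 0, zero_add]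
  have hcongr : ∫ t in (0 : ℝ)..1, sawtooth (t : AddCircle (1 : ℝ)) =
      ∫ t in (0 : ℝ)..1, (1 / 2 - t) := by
    refine intervalIntegral.integral_congr_Ioo_of_le zero_le_one fun t ht => ?_
    rw [sawtooth_coe, Int.fract_eq_self.2 ⟨ht.1.le, ht.2⟩]
  rw [hcongr, intervalIntegral.integral_sub (by simp) (by simp)]
  norm_num [integral_id]

/-- If bounded kernels asymptotically annihilate all characters, uniformly under convolution,
then they asymptotically annihilate all integrable functions. -/
theorem eventually_norm_integral_mul_le_of_fourier {B : ℕ → AddCircle (1 : ℝ) → ℝ} {C : ℝ}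
    (hB : ∀ k, Measurable (B k)) (hC : ∀ k u, |B k u| ≤ C)
    (hF : ∀ n : ℤ, ∀ ε > 0, ∀ᶠ k in atTop, ∀ x : AddCircle (1 : ℝ),
      ‖∫ t, (B k (x - t) : ℂ) * fourier n t ∂haarAddCircle‖ ≤ ε)
    (v : Lp ℂ 1 (haarAddCircle : Measure (AddCircle (1 : ℝ)))) :
    ∀ ε > 0, ∀ᶠ k in atTop, ∀ x : AddCircle (1 : ℝ),
      ‖∫ t, (B k (x - t) : ℂ) * v t ∂haarAddCircle‖ ≤ ε := by
  have hC0 : 0 ≤ C := (abs_nonneg _).trans (hC 0 0)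
  have hint : ∀ k x (w : Lp ℂ 1 (haarAddCircle : Measure (AddCircle (1 : ℝ)))),
      Integrable (fun t => (B k (x - t) : ℂ) * w t) haarAddCircle := by
    intro k x w
    refine (L1.integrable_coeFn w).bdd_mul (c := C) ?_ (ae_of_all _ fun t => ?_)
    · have := hB k
      exact (Complex.measurable_ofReal.comp (by fun_prop)).aestronglyMeasurable
    · rw [Complex.norm_real]; exact hC k _
  have hadd : ∀ k x (w w' : Lp ℂ 1 (haarAddCircle : Measure (AddCircle (1 : ℝ)))),
      ∫ t, (B k (x - t) : ℂ) * (w + w') t ∂haarAddCircle =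
        ∫ t, (B k (x - t) : ℂ) * w t ∂haarAddCircle +
          ∫ t, (B k (x - t) : ℂ) * w' t ∂haarAddCircle := by
    intro k x w w'
    rw [← integral_add (hint k x w) (hint k x w')]
    refine integral_congr_ae ?_
    filter_upwards [Lp.coeFn_add w w'] with t ht
    rw [ht, Pi.add_apply, mul_add]
  have hbd : ∀ k x (w : Lp ℂ 1 (haarAddCircle : Measure (AddCircle (1 : ℝ)))),
      ‖∫ t, (B k (x - t) : ℂ) * w t ∂haarAddCircle‖ ≤ C * ‖w‖ := by
    intro k x w
    rw [L1.norm_eq_integral_norm, ← integral_const_mul]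
    refine norm_integral_le_of_norm_le ((L1.integrable_coeFn w).norm.const_mul C)
      (ae_of_all _ fun t => ?_)
    rw [norm_mul, Complex.norm_real]
    exact mul_le_mul_of_nonneg_right (hC k _) (norm_nonneg _)
  let W : Submodule ℂ (Lp ℂ 1 (haarAddCircle : Measure (AddCircle (1 : ℝ)))) :=
    { carrier := {w | ∀ ε > 0, ∀ᶠ k in atTop, ∀ x : AddCircle (1 : ℝ),
        ‖∫ t, (B k (x - t) : ℂ) * w t ∂haarAddCircle‖ ≤ ε}
      add_mem' := by
        intro w w' hw hw' ε hε
        filter_upwards [hw (ε / 2) (half_pos hε), hw' (ε / 2) (half_pos hε)] with k h1 h2 x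
        rw [hadd]
        linarith [norm_add_le (∫ t, (B k (x - t) : ℂ) * w t ∂haarAddCircle)
          (∫ t, (B k (x - t) : ℂ) * w' t ∂haarAddCircle), h1 x, h2 x]
      zero_mem' := by
        intro ε hε
        filter_upwards with k x
        simpa using (hbd k x 0).trans (by simpa using hε.le)
      smul_mem' := by
        intro c w hw ε hε
        filter_upwards [hw (ε / (‖c‖ + 1)) (by positivity)] with k hk x
        have hcw : ∫ t, (B k (x - t) : ℂ) * (c • w) t ∂haarAddCircle =
            c * ∫ t, (B k (x - t) : ℂ) * w t ∂haarAddCircle := by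
          rw [← integral_const_mul]
          refine integral_congr_ae ?_
          filter_upwards [Lp.coeFn_smul c w] with t ht
          rw [ht, Pi.smul_apply, smul_eq_mul]
          ring
        rw [hcw, norm_mul]
        calc ‖c‖ * _ ≤ (‖c‖ + 1) * (ε / (‖c‖ + 1)) :=
              mul_le_mul (by linarith) (hk x) (norm_nonneg _) (by positivity)
          _ = ε := by field_simp }
  have hWclosed : IsClosed (W : Set (Lp ℂ 1 (haarAddCircle : Measure (AddCircle (1 : ℝ))))) := by
    refine isClosed_of_closure_subset fun w hw ε hε => ?_
    obtain ⟨w', hw', hdist⟩ := Metric.mem_closure_iff.1 hw (ε / 2 / (C + 1)) (by positivity)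
    filter_upwards [hw' (ε / 2) (half_pos hε)] with k hk x
    have h1 := hadd k x w' (w - w')
    rw [add_sub_cancel] at h1
    have h2 := hbd k x (w - w')
    rw [dist_eq_norm] at hdist
    have h3 : C * ‖w - w'‖ ≤ ε / 2 := by
      calc C * ‖w - w'‖ ≤ (C + 1) * (ε / 2 / (C + 1)) := by gcongr; linarith
        _ = ε / 2 := by field_simp
    rw [h1]
    exact (norm_add_le _ _).trans (by linarith [hk x])
  have hspan : Submodule.span ℂ (Set.range (fourierLp (T := 1) 1)) ≤ W := by
    refine Submodule.span_le.2 ?_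
    rintro _ ⟨n, rfl⟩ ε hε
    filter_upwards [hF n ε hε] with k hk x
    refine le_of_eq_of_le (congrArg _ (integral_congr_ae ?_)) (hk x)
    filter_upwards [coeFn_fourierLp (T := 1) 1 n] with t ht
    rw [ht]
  have htop := Submodule.topologicalClosure_minimal _ hspan hWclosed
  rw [span_fourierLp_closure_eq_top ENNReal.one_ne_top] at htop
  exact htop (Submodule.mem_top (x := v))

theorem fourier_add_apply (n : ℤ) (x y : AddCircle (1 : ℝ)) :
    fourier n (x + y) = fourier n x * fourier n y := by
  simp only [fourier_apply, smul_add, toCircle_add, Circle.coe_mul]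

theorem fourier_nsmul_apply (n : ℤ) (i : ℕ) (x : AddCircle (1 : ℝ)) :
    fourier n (i • x) = fourier n x ^ i := by
  induction i with
  | zero => simp
  | succ i ih => rw [succ_nsmul, fourier_add_apply, ih, pow_succ]

theorem fourier_coe_ne_one {α : ℝ} (hα : Irrational α) {n : ℤ} (hn : n ≠ 0) :
    fourier n (α : AddCircle (1 : ℝ)) ≠ 1 := by
  intro h
  rw [fourier_apply, ← Circle.coe_one, Circle.coe_inj, ← toCircle_zero (T := 1)] at h
  have h0 := injective_toCircle one_ne_zero h
  rw [← AddCircle.coe_zsmul, AddCircle.coe_eq_zero_iff] at h0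
  obtain ⟨m, hm⟩ := h0
  rw [zsmul_eq_mul, zsmul_eq_mul, mul_one] at hm
  exact (hα.intCast_mul hn).ne_int m hm.symm

/-- Convolution of Birkhoff sums of the sawtooth function with a character. -/
theorem integral_sum_sawtooth_mul_fourier (a : AddCircle (1 : ℝ)) (n : ℤ) (q : ℕ)
    (x : AddCircle (1 : ℝ)) :
    ∫ t, ((∑ i ∈ Finset.range q, sawtooth (x - t + i • a) : ℝ) : ℂ) * fourier n t
        ∂haarAddCircle =
      fourier n x * ((∑ i ∈ Finset.range q, fourier n a ^ i) *
        ∫ u, (sawtooth u : ℂ) * fourier n (-u) ∂haarAddCircle) := by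
  have hint : ∀ c : AddCircle (1 : ℝ), Integrable
      (fun t => (sawtooth (c - t) : ℂ) * fourier n t) haarAddCircle := by
    intro c
    have hfi : Integrable (fun t : AddCircle (1 : ℝ) => fourier n t) haarAddCircle :=
      (map_continuous (fourier n)).integrable_of_hasCompactSupport
        (HasCompactSupport.of_compactSpace _)
    refine hfi.bdd_mul (c := 1 / 2) ?_ (ae_of_all _ fun t => ?_)
    · have := measurable_sawtooth
      exact (Complex.measurable_ofReal.comp (by fun_prop)).aestronglyMeasurable
    · rw [Complex.norm_real]; exact abs_sawtooth_le _
  have hone : ∀ c : AddCircle (1 : ℝ),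
      ∫ t, (sawtooth (c - t) : ℂ) * fourier n t ∂haarAddCircle =
        fourier n c * ∫ u, (sawtooth u : ℂ) * fourier n (-u) ∂haarAddCircle := by
    intro c
    rw [← integral_const_mul,
      ← integral_sub_left_eq_self (fun u => fourier n c * ((sawtooth u : ℂ) * fourier n (-u))) _ c]
    refine integral_congr_ae (ae_of_all _ fun t => ?_)
    have : fourier n t = fourier n c * fourier n (-(c - t)) := by
      rw [← fourier_add_apply]; congr 1; abel
    simp only [this]
    ring
  have hsum : ∀ t, ((∑ i ∈ Finset.range q, sawtooth (x - t + i • a) : ℝ) : ℂ) * fourier n t =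
      ∑ i ∈ Finset.range q, (sawtooth (x + i • a - t) : ℂ) * fourier n t := by
    intro t
    rw [Complex.ofReal_sum, Finset.sum_mul]
    refine Finset.sum_congr rfl fun i _ => ?_
    rw [sub_add_eq_add_sub]
  simp only [hsum]
  rw [integral_finsetSum _ fun i _ => hint _]
  simp only [hone, fourier_add_apply, fourier_nsmul_apply]
  rw [Finset.sum_mul, Finset.mul_sum]
  exact Finset.sum_congr rfl fun i _ => by ring

theorem abs_sum_sawtooth_le {α : ℝ} {r : ℚ} (hr : |α - r| ≤ 1 / (r.den : ℝ) ^ 2)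
    (u : AddCircle (1 : ℝ)) :
    |∑ i ∈ Finset.range r.den, sawtooth (u + i • (α : AddCircle (1 : ℝ)))| ≤ 3 := by
  obtain ⟨s, rfl⟩ := QuotientAddGroup.mk_surjective u
  have hcop : IsCoprime r.num (r.den : ℤ) := by
    rw [Int.isCoprime_iff_gcd_eq_one]; exact r.reduced
  rw [Rat.cast_def] at hr
  refine le_of_eq_of_le (congrArg _ (Finset.sum_congr rfl fun i _ => ?_))
    (abs_sum_range_half_sub_fract_le r.pos hcop hr s)
  rw [← sawtooth_coe, AddCircle.coe_add, ← nsmul_eq_mul, AddCircle.coe_nsmul]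

theorem integral_birkhoffCocycle {α : ℝ} {φ : AddCircle (1 : ℝ) → ℝ} (hφ : Continuous φ)
    (hmean : ∫ x, φ x = 0) (q : ℕ) : ∫ x, birkhoffCocycle α φ q x = 0 := by
  simp only [birkhoffCocycle_natCast]
  rw [integral_finsetSum]
  · exact Finset.sum_eq_zero fun i _ => by rw [integral_add_right_eq_self, hmean]
  · exact fun i _ => Continuous.integrable_of_hasCompactSupport (by fun_prop)
      (HasCompactSupport.of_compactSpace _)

theorem uniformlyRecurrent_of_absolutelyContinuous {α : ℝ} {φ : AddCircle (1 : ℝ) → ℝ}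
    (hα : Irrational α) (hφ : Continuous φ) (hmean : ∫ x, φ x = 0)
    (hac : AbsolutelyContinuous' φ) : UniformlyRecurrent α φ := by
  obtain ⟨K, v, hv, hrep⟩ := hac.exists_eq_add_integral
  choose r hrN hr2 hr1 using fun k : ℕ =>
    exists_rat_approx hα (Nat.one_div_pos_of_nat (α := ℝ) (n := k)) k
  set a : AddCircle (1 : ℝ) := (α : AddCircle (1 : ℝ)) with ha
  let B : ℕ → AddCircle (1 : ℝ) → ℝ :=
    fun k u => ∑ i ∈ Finset.range (r k).den, sawtooth (u + i • a)
  have hnorm : ∀ k, ‖(r k).den • a‖ < 1 / ((k : ℝ) + 1) := by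
    intro k
    have h1 : (r k).den • a = (((r k).den * α - (r k).num : ℝ) : AddCircle (1 : ℝ)) := by
      have h2 : (((r k).num : ℝ) : AddCircle (1 : ℝ)) = 0 :=
        (AddCircle.coe_eq_zero_iff 1).2 ⟨(r k).num, by simp⟩
      rw [AddCircle.coe_sub, h2, sub_zero, ← nsmul_eq_mul, AddCircle.coe_nsmul]
    rw [h1]
    exact (AddCircle.norm_coe_le_abs _).trans_lt (hr1 k)
  have hlim : Tendsto (fun k => (r k).den • a) atTop (𝓝 0) :=
    squeeze_zero_norm (fun k => (hnorm k).le) tendsto_one_div_add_atTop_nhds_zero_nat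
  have hBmeas : ∀ k, Measurable (B k) := fun k =>
    Finset.measurable_sum _ fun i _ => measurable_sawtooth.comp (measurable_id.add_const _)
  have hBC : ∀ k u, |B k u| ≤ 3 := fun k u => abs_sum_sawtooth_le (hr2 k) u
  have hF : ∀ n : ℤ, ∀ ε > 0, ∀ᶠ k in atTop, ∀ x : AddCircle (1 : ℝ),
      ‖∫ t, (B k (x - t) : ℂ) * fourier n t ∂haarAddCircle‖ ≤ ε := by
    intro n ε hε
    have htend : Tendsto (fun k => (∑ i ∈ Finset.range (r k).den, fourier n a ^ i) *
        ∫ u, (sawtooth u : ℂ) * fourier n (-u) ∂haarAddCircle) atTop (𝓝 0) := by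
      rcases eq_or_ne n 0 with rfl | hn
      · have h0 : ∫ u, (sawtooth u : ℂ) * fourier 0 (-u) ∂haarAddCircle = 0 := by
          simp only [fourier_zero, mul_one]
          rw [haarAddCircle_one_eq_volume, integral_complex_ofReal, integral_sawtooth,
            Complex.ofReal_zero]
        simp only [h0, mul_zero, tendsto_const_nhds]
      · have h1 : Tendsto (fun k => fourier n ((r k).den • a)) atTop (𝓝 1) := by
          have := ((map_continuous (fourier (T := 1) n)).tendsto 0).comp hlim
          rwa [fourier_eval_zero] at this
        have h2 : Tendsto (fun k => (fourier n a ^ (r k).den - 1) / (fourier n a - 1)) atTop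
            (𝓝 0) := by
          simp only [fourier_nsmul_apply] at h1
          simpa using (h1.sub_const 1).div_const (fourier n a - 1)
        have hne : fourier n a ≠ 1 := fourier_coe_ne_one hα hn
        simp only [geom_sum_eq hne]
        simpa using h2.mul_const _
    filter_upwards [(tendsto_zero_iff_norm_tendsto_zero.1 htend).eventually_le_const hε]
      with k hk x
    rw [integral_sum_sawtooth_mul_fourier, norm_mul]
    rwa [show ‖fourier n x‖ = 1 from Circle.norm_coe _, one_mul]
  have hvC : Integrable (fun t => (v t : ℂ)) haarAddCircle := by
    rw [haarAddCircle_one_eq_volume]; exact hv.ofReal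
  have hvB := eventually_norm_integral_mul_le_of_fourier hBmeas hBC hF (hvC.toL1 _)
  have hS : ∀ k x, birkhoffCocycle α φ (r k).den x =
      (r k).den * K + ∫ t, B k (x - t) * v t := by
    intro k x
    have hint : ∀ c : AddCircle (1 : ℝ), Integrable (fun t => sawtooth (c - t) * v t) := by
      intro c
      have := measurable_sawtooth
      exact hv.bdd_mul (c := 1 / 2) (Measurable.aestronglyMeasurable (by fun_prop))
        (ae_of_all _ fun t => abs_sawtooth_le _)
    rw [birkhoffCocycle_natCast]
    simp only [hrep, Finset.sum_add_distrib, Finset.sum_const, Finset.card_range, nsmul_eq_mul]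
    rw [← integral_finsetSum _ fun i _ => hint _]
    simp only [B, Finset.sum_mul, sub_add_eq_add_sub, ha]
  have hBv : ∀ k x, ‖∫ t, (B k (x - t) : ℂ) * hvC.toL1 _ t ∂haarAddCircle‖ =
      |∫ t, B k (x - t) * v t| := by
    intro k x
    rw [← Real.norm_eq_abs, ← Complex.norm_real, ← integral_complex_ofReal,
      ← haarAddCircle_one_eq_volume]
    refine congrArg _ (integral_congr_ae ?_)
    filter_upwards [hvC.coeFn_toL1] with t ht
    rw [ht, Complex.ofReal_mul]
  intro ε hε N
  have hone : ∀ᶠ k : ℕ in atTop, 1 / ((k : ℝ) + 1) < ε :=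
    tendsto_one_div_add_atTop_nhds_zero_nat.eventually_lt_const hε
  obtain ⟨k, hkN, hkε, hk⟩ :=
    ((eventually_ge_atTop N).and (hone.and (hvB (ε / 3) (by positivity)))).exists
  simp only [hBv] at hk
  refine ⟨(r k).den, hkN.trans (hrN k), ?_, fun x => ?_⟩
  · rw [natCast_zsmul]; exact (hnorm k).trans hkε
  · have hdev : ∀ x, |birkhoffCocycle α φ (r k).den x - (r k).den * K| ≤ ε / 3 := by
      intro x; rw [hS, add_sub_cancel_left]; exact hk x
    have hK : |(r k).den * K| ≤ ε / 3 := by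
      have hSi : Integrable (birkhoffCocycle α φ (r k).den) :=
        (continuous_birkhoffCocycle hφ _).integrable_of_hasCompactSupport
          (HasCompactSupport.of_compactSpace _)
      have h1 : ∫ x : AddCircle (1 : ℝ), (birkhoffCocycle α φ (r k).den x - (r k).den * K) =
          -((r k).den * K) := by
        rw [integral_sub hSi (integrable_const _), integral_birkhoffCocycle hφ hmean]
        simp [measureReal_def]
      have h2 := norm_integral_le_of_norm_le_const (μ := (volume : Measure (AddCircle (1 : ℝ))))
        (f := fun x => birkhoffCocycle α φ (r k).den x - (r k).den * K) (ae_of_all _ hdev)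
      rw [h1] at h2
      simpa [measureReal_def] using h2
    have := abs_add_le (birkhoffCocycle α φ (r k).den x - (r k).den * K) ((r k).den * K)
    rw [sub_add_cancel] at this
    linarith [hdev x]

end DenjoyKoksma

/-- The sets `D`, `P`, `N` are nonempty, pairwise disjoint Borel sets partitioning `ℝ/ℤ`. -/
theorem stmt_6 (α : ℝ) (φ : AddCircle (1 : ℝ) → ℝ) (h : AnzaiConds α φ) :
    let D : Set (AddCircle (1 : ℝ)) := {x | Lx α φ x = Set.univ}
    let P : Set (AddCircle (1 : ℝ)) := {x | Lx α φ x = Set.Ici 0}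
    let N : Set (AddCircle (1 : ℝ)) := {x | Lx α φ x = Set.Iic 0}
    D.Nonempty ∧ P.Nonempty ∧ N.Nonempty ∧
      Disjoint D P ∧ Disjoint D N ∧ Disjoint P N ∧
      MeasurableSet D ∧ MeasurableSet P ∧ MeasurableSet N ∧
      D ∪ P ∪ N = Set.univ := by
  obtain ⟨hα, hφ, hmean, hcob, hac⟩ := h
  exact trichotomy_of_uniformlyRecurrent hα hφ
    (uniformlyRecurrent_of_absolutelyContinuous hα hφ hmean hac) hcob
end
end

section
/- (Improved Denjoy–Koksma theorem.) Let α be irrational and let φ : ℝ/ℤ → ℝ be absolutely continuous with ∫_{ℝ/ℤ} φ(x) dx = 0. Let (q_n) be a strictly increasing sequence of closest return times for α, and for a positive integer m set φ_m(x) = Σ_{i=0}^{m−1} φ(x+iα). Then sup_{x ∈ ℝ/ℤ} |φ_{q_n}(x)| → 0 as n → ∞. -/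
open Filter Topology MeasureTheory

noncomputable section

/-- `q` is a closest return time for `α`: `‖jα‖ > ‖qα‖` for every `0 < j < q`, where `‖·‖`
is the distance to the nearest integer. -/
def IsClosestReturnTime (α : ℝ) (q : ℕ) : Prop :=
  0 < q ∧ ∀ j : ℕ, 0 < j → j < q →
    ‖(((j : ℝ) * α : ℝ) : AddCircle (1 : ℝ))‖ > ‖(((q : ℝ) * α : ℝ) : AddCircle (1 : ℝ))‖

/-- A closest return time `q` comes with a reduced fraction `p / q` such that
`|q α - p| = ‖q α‖ ≤ 1 / (q + 1)`. -/
theorem IsClosestReturnTime.exists_isCoprime {α : ℝ} {q : ℕ}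
    (h : IsClosestReturnTime α q) :
    ∃ p : ℤ, IsCoprime p (q : ℤ) ∧ |q * α - p| ≤ 1 / (q + 1) ∧
      ‖(((q : ℝ) * α : ℝ) : AddCircle (1 : ℝ))‖ ≤ 1 / (q + 1) := by
  obtain ⟨hq, hj⟩ := h
  have hbound : ‖(((q : ℝ) * α : ℝ) : AddCircle (1 : ℝ))‖ ≤ 1 / (q + 1) := by
    obtain ⟨k, hk0, hkq, hk⟩ := Real.exists_nat_abs_mul_sub_round_le α hq
    rw [← UnitAddCircle.norm_eq] at hk
    rcases hkq.lt_or_eq with hlt | rfl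
    · exact (hj k hk0 hlt).le.trans hk
    · exact hk
  have hnorm : |q * α - round (q * α)| = ‖(((q : ℝ) * α : ℝ) : AddCircle (1 : ℝ))‖ :=
    UnitAddCircle.norm_eq.symm
  refine ⟨round (q * α), ?_, hnorm ▸ hbound, hbound⟩
  rw [Int.isCoprime_iff_gcd_eq_one]
  set p := round ((q : ℝ) * α) with hp
  set d := Int.gcd p q with hd
  have hd0 : 0 < d := Int.gcd_pos_of_ne_zero_right _ (by exact_mod_cast hq.ne')
  by_contra hd1
  obtain ⟨a, ha⟩ : (d : ℤ) ∣ p := Int.gcd_dvd_left ..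
  obtain ⟨b, hb⟩ : d ∣ q := Int.natCast_dvd_natCast.1 (Int.gcd_dvd_right p q)
  have hb0 : 0 < b := Nat.pos_of_ne_zero (by rintro rfl; simp at hb; omega)
  have hd2 : 2 ≤ d := by omega
  have hbq : b < q := by rw [hb]; nlinarith
  have hlt := hj b hb0 hbq
  rw [← hnorm, UnitAddCircle.norm_eq] at hlt
  have hle := round_le ((b : ℝ) * α) a
  have hfac : (q : ℝ) * α - p = d * (b * α - a) := by
    rw [ha]; nth_rewrite 1 [hb]; push_cast; ring
  rw [hfac, abs_mul, Nat.abs_cast] at hlt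
  have hd2' : (2 : ℝ) ≤ d := by exact_mod_cast hd2
  nlinarith [abs_nonneg ((b : ℝ) * α - a)]

/-- `φ` is a primitive on the circle of the integrable function `G`. -/
def IsCirclePrimitive (φ G : AddCircle (1 : ℝ) → ℂ) : Prop :=
  Integrable G ∧ ∀ a b : ℝ, φ b - φ a = ∫ t in a..b, G t

theorem intervalIntegrable_comp_coe_addCircle {E : Type*} [NormedAddCommGroup E]
    {F : AddCircle (1 : ℝ) → E} (hF : Integrable F) (a b : ℝ) :
    IntervalIntegrable (fun t : ℝ => F t) volume a b := by
  have hper : Function.Periodic (fun t : ℝ => F t) 1 := fun t => by simp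
  refine hper.intervalIntegrable one_ne_zero (t := 0) ?_ a b
  rw [intervalIntegrable_iff_integrableOn_Ioc_of_le (by norm_num)]
  exact (UnitAddCircle.measurePreserving_mk 0).integrable_comp_of_integrable hF

namespace IsCirclePrimitive

variable {φ G : AddCircle (1 : ℝ) → ℂ}

theorem continuous_comp_coe (h : IsCirclePrimitive φ G) : Continuous fun t : ℝ => φ t := by
  have heq : (fun t : ℝ => φ t) = fun t : ℝ => φ (0 : ℝ) + ∫ s in (0 : ℝ)..t, G s := by
    ext t
    rw [← h.2, add_sub_cancel]
  rw [heq]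
  exact continuous_const.add
    (intervalIntegral.continuous_primitive (intervalIntegrable_comp_coe_addCircle h.1) 0)

theorem continuous (h : IsCirclePrimitive φ G) : Continuous φ :=
  (QuotientAddGroup.isQuotientMap_mk (N := AddSubgroup.zmultiples (1 : ℝ))).continuous_iff.2
    h.continuous_comp_coe

theorem integrable (h : IsCirclePrimitive φ G) : Integrable φ :=
  h.continuous.integrable_of_hasCompactSupport (HasCompactSupport.of_compactSpace _)

theorem integral_eq_zero (h : IsCirclePrimitive φ G) : ∫ t, G t = 0 := by
  rw [← UnitAddCircle.intervalIntegral_preimage 0, ← h.2, zero_add, AddCircle.coe_period,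
    AddCircle.coe_zero, sub_self]

theorem sub {φ' G' : AddCircle (1 : ℝ) → ℂ} (h : IsCirclePrimitive φ G)
    (h' : IsCirclePrimitive φ' G') : IsCirclePrimitive (φ - φ') (G - G') := by
  refine ⟨h.1.sub h'.1, fun a b => ?_⟩
  simp only [Pi.sub_apply]
  rw [intervalIntegral.integral_sub (intervalIntegrable_comp_coe_addCircle h.1 a b)
    (intervalIntegrable_comp_coe_addCircle h'.1 a b), ← h.2, ← h'.2]
  ring

/-- Oscillation of a primitive around its average over an interval of length `L`. -/
theorem norm_sub_average_le (h : IsCirclePrimitive φ G) (y d : ℝ) {L : ℝ} (hL : 0 < L)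
    (hd : |d| ≤ L) :
    ‖φ (y + d : ℝ) - (L : ℂ)⁻¹ * ∫ s in (0 : ℝ)..L, φ (y + s : ℝ)‖ ≤
      (∫ s in (0 : ℝ)..L, ‖G (y - L + s : ℝ)‖) + ∫ s in (0 : ℝ)..L, ‖G (y + s : ℝ)‖ := by
  have hL' : (L : ℂ) ≠ 0 := by exact_mod_cast hL.ne'
  have hG := intervalIntegrable_comp_coe_addCircle h.1.norm
  have hrhs : (∫ s in (0 : ℝ)..L, ‖G (y - L + s : ℝ)‖) + ∫ s in (0 : ℝ)..L, ‖G (y + s : ℝ)‖ =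
      ∫ t in (y - L)..(y + L), ‖G t‖ := by
    rw [intervalIntegral.integral_comp_add_left (fun t : ℝ => ‖G t‖),
      intervalIntegral.integral_comp_add_left (fun t : ℝ => ‖G t‖)]
    simp only [add_zero, sub_add_cancel]
    exact intervalIntegral.integral_add_adjacent_intervals (hG _ _) (hG _ _)
  rw [hrhs]
  set C := ∫ t in (y - L)..(y + L), ‖G t‖ with hC
  have hC0 : 0 ≤ C := intervalIntegral.integral_nonneg (by linarith) fun _ _ => norm_nonneg _
  have hpt : ∀ s ∈ Set.uIoc (0 : ℝ) L, ‖φ (y + d : ℝ) - φ (y + s : ℝ)‖ ≤ C := by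
    intro s hs
    rw [Set.uIoc_of_le hL.le] at hs
    rw [h.2]
    refine intervalIntegral.norm_integral_le_abs_integral_norm.trans ?_
    rw [← abs_of_nonneg hC0]
    refine intervalIntegral.abs_integral_mono_interval ?_
      (Eventually.of_forall fun _ => norm_nonneg _) (hG _ _)
    rw [abs_le] at hd
    rw [Set.uIoc_of_le (by linarith : y - L ≤ y + L)]
    exact Set.Ioc_subset_Ioc (le_min (by linarith [hs.1]) (by linarith))
      (max_le (by linarith [hs.2]) (by linarith))
  have hint := intervalIntegral.norm_integral_le_of_norm_le_const hpt
  have hcont : Continuous fun s : ℝ => φ (y + s : ℝ) :=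
    h.continuous_comp_coe.comp (continuous_const.add continuous_id)
  rw [intervalIntegral.integral_sub intervalIntegrable_const (hcont.intervalIntegrable _ _),
    intervalIntegral.integral_const, sub_zero, abs_of_pos hL] at hint
  have hfac : φ (y + d : ℝ) - (L : ℂ)⁻¹ * ∫ s in (0 : ℝ)..L, φ (y + s : ℝ) =
      (L : ℂ)⁻¹ * (L • φ (y + d : ℝ) - ∫ s in (0 : ℝ)..L, φ (y + s : ℝ)) := by
    rw [Complex.real_smul, mul_sub, inv_mul_cancel_left₀ hL']
  rw [hfac, norm_mul, norm_inv, Complex.norm_real, Real.norm_of_nonneg hL.le,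
    inv_mul_le_iff₀ hL]
  linarith

end IsCirclePrimitive

/-- Multiplication by an integer coprime to `q` permutes the `q`-division points of the circle. -/
theorem sum_range_coe_mul_div_eq {E : Type*} [AddCommMonoid E] (H : AddCircle (1 : ℝ) → E)
    {q : ℕ} (hq : 0 < q) {p : ℤ} (hp : IsCoprime p (q : ℤ)) :
    ∑ i ∈ Finset.range q, H ((i * p / q : ℝ) : AddCircle (1 : ℝ)) =
      ∑ i ∈ Finset.range q, H ((i / q : ℝ) : AddCircle (1 : ℝ)) := by
  have : NeZero q := ⟨hq.ne'⟩
  have hrange : ∀ K : ZMod q → E, ∑ i ∈ Finset.range q, K (i : ZMod q) = ∑ a, K a := by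
    intro K
    refine Finset.sum_bij' (fun i _ => (i : ZMod q)) (fun a _ => a.val) (by simp) ?_ ?_ ?_ (by simp)
    · intro a _
      simpa using ZMod.val_lt a
    · intro i hi
      exact ZMod.val_cast_of_lt (Finset.mem_range.1 hi)
    · simp
  obtain ⟨u, v, huv⟩ := hp
  have hu : (u : ZMod q) * p = 1 := by
    have := congrArg (Int.cast : ℤ → ZMod q) huv
    simpa using this
  have hunit : IsUnit (p : ZMod q) := IsUnit.of_mul_eq_one_right _ hu
  calc ∑ i ∈ Finset.range q, H ((i * p / q : ℝ) : AddCircle (1 : ℝ))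
      = ∑ i ∈ Finset.range q, H (ZMod.toAddCircle ((i : ZMod q) * (p : ZMod q))) := by
        refine Finset.sum_congr rfl fun i _ => ?_
        have := ZMod.toAddCircle_intCast (N := q) (i * p)
        push_cast at this
        rw [this]
    _ = ∑ a : ZMod q, H (ZMod.toAddCircle (a * (p : ZMod q))) :=
        hrange fun a => H (ZMod.toAddCircle (a * (p : ZMod q)))
    _ = ∑ a : ZMod q, H (ZMod.toAddCircle a) :=
        Equiv.sum_comp hunit.unit.mulRight fun a => H (ZMod.toAddCircle a)
    _ = ∑ i ∈ Finset.range q, H (ZMod.toAddCircle (i : ZMod q)) :=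
        (hrange fun a => H (ZMod.toAddCircle a)).symm
    _ = _ := by simp_rw [ZMod.toAddCircle_natCast]

/-- The intervals of length `1 / q` starting at the points `x + i p / q` tile the circle. -/
theorem sum_range_integral_eq_integral {E : Type*} [NormedAddCommGroup E] [NormedSpace ℝ E]
    {F : AddCircle (1 : ℝ) → E} (hF : Integrable F) {q : ℕ} (hq : 0 < q) {p : ℤ}
    (hp : IsCoprime p (q : ℤ)) (x : ℝ) :
    ∑ i ∈ Finset.range q, ∫ s in (0 : ℝ)..(1 / q), F (x + i * p / q + s : ℝ) = ∫ t, F t := by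
  have hq0 : (q : ℝ) ≠ 0 := by exact_mod_cast hq.ne'
  have hperm := sum_range_coe_mul_div_eq
    (fun z => ∫ s in (0 : ℝ)..(1 / q), F ((x : AddCircle (1 : ℝ)) + z + s)) hq hp
  simp only [← AddCircle.coe_add] at hperm
  rw [hperm]
  have hadj := intervalIntegral.sum_integral_adjacent_intervals (f := fun t : ℝ => F t)
    (μ := volume) (a := fun i : ℕ => x + i / q) (n := q)
    fun k _ => intervalIntegrable_comp_coe_addCircle hF _ _
  rw [← UnitAddCircle.intervalIntegral_preimage x]
  simp only [Nat.cast_zero, zero_div, add_zero, div_self hq0] at hadj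
  rw [← hadj]
  refine Finset.sum_congr rfl fun i _ => ?_
  rw [intervalIntegral.integral_comp_add_left (fun t : ℝ => F t)]
  congr 1
  · ring
  · push_cast; ring

/-- Denjoy–Koksma inequality for a zero-mean function with integrable derivative. -/
theorem IsCirclePrimitive.norm_birkhoffSum_le {φ G : AddCircle (1 : ℝ) → ℂ}
    (h : IsCirclePrimitive φ G) (hφ : ∫ t, φ t = 0) {α : ℝ} {q : ℕ}
    (hq : IsClosestReturnTime α q) (x : AddCircle (1 : ℝ)) :
    ‖∑ i ∈ Finset.range q, φ (x + ((i * α : ℝ) : AddCircle (1 : ℝ)))‖ ≤ 2 * ∫ t, ‖G t‖ := by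
  obtain ⟨p, hp, hpα, -⟩ := hq.exists_isCoprime
  obtain ⟨x, rfl⟩ := QuotientAddGroup.mk_surjective x
  have hq0 : (0 : ℝ) < q := by exact_mod_cast hq.1
  have hL : (0 : ℝ) < 1 / q := by positivity
  have hterm : ∀ i ∈ Finset.range q,
      ‖φ (x + i * α : ℝ) -
        ((1 / q : ℝ) : ℂ)⁻¹ * ∫ s in (0 : ℝ)..(1 / q), φ (x + i * p / q + s : ℝ)‖ ≤
      (∫ s in (0 : ℝ)..(1 / q), ‖G (x - 1 / q + i * p / q + s : ℝ)‖) +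
        ∫ s in (0 : ℝ)..(1 / q), ‖G (x + i * p / q + s : ℝ)‖ := by
    intro i hi
    have hi' : (i : ℝ) ≤ q := by exact_mod_cast (Finset.mem_range.1 hi).le
    have hd : |(i / q : ℝ) * (q * α - p)| ≤ 1 / q := by
      rw [abs_mul, abs_of_nonneg (by positivity)]
      calc (i / q : ℝ) * |q * α - p| ≤ 1 * (1 / (q + 1)) :=
            mul_le_mul ((div_le_one hq0).2 hi') hpα (abs_nonneg _) zero_le_one
        _ ≤ 1 / q := by rw [one_mul]; gcongr; linarith
    have := h.norm_sub_average_le (x + i * p / q) (i / q * (q * α - p)) hL hd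
    have e1 : x + i * p / q + i / q * (q * α - p) = x + i * α := by field_simp; ring
    have e2 : x + i * p / q - 1 / q = x - 1 / q + i * p / q := by ring
    rwa [e1, e2] at this
  have hsum : ∑ i ∈ Finset.range q, φ (x + i * α : ℝ) = ∑ i ∈ Finset.range q,
      (φ (x + i * α : ℝ) -
        ((1 / q : ℝ) : ℂ)⁻¹ * ∫ s in (0 : ℝ)..(1 / q), φ (x + i * p / q + s : ℝ)) := by
    rw [Finset.sum_sub_distrib, ← Finset.mul_sum,
      sum_range_integral_eq_integral h.integrable hq.1 hp, hφ, mul_zero, sub_zero]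
  change ‖∑ i ∈ Finset.range q, φ (x + i * α : ℝ)‖ ≤ _
  rw [hsum]
  refine (norm_sum_le_of_le _ hterm).trans ?_
  rw [Finset.sum_add_distrib, sum_range_integral_eq_integral h.1.norm hq.1 hp,
    sum_range_integral_eq_integral h.1.norm hq.1 hp, two_mul]

/-- Birkhoff sums of a nontrivial character tend uniformly to zero along rigidity times. -/
theorem tendstoUniformly_birkhoffSum_fourier {α : ℝ} (hα : Irrational α) {q : ℕ → ℕ}
    (hq : Tendsto (fun n => (((q n : ℝ) * α : ℝ) : AddCircle (1 : ℝ))) atTop (𝓝 0))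
    {k : ℤ} (hk : k ≠ 0) :
    TendstoUniformly (fun n (x : AddCircle (1 : ℝ)) => ∑ i ∈ Finset.range (q n),
      fourier k (x + (((i : ℝ) * α : ℝ) : AddCircle (1 : ℝ)))) 0 atTop := by
  set z : ℂ := fourier k (α : AddCircle (1 : ℝ)) with hz
  have hpow : ∀ i : ℕ, fourier k (((i : ℝ) * α : ℝ) : AddCircle (1 : ℝ)) = z ^ i := by
    intro i
    rw [hz, fourier_coe_apply, fourier_coe_apply, ← Complex.exp_nat_mul]
    congr 1
    push_cast
    ring
  have hz1 : z - 1 ≠ 0 := by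
    rw [sub_ne_zero, hz, fourier_coe_apply]
    intro h
    obtain ⟨n, hn⟩ := Complex.exp_eq_one_iff.1 h
    have hn' : (2 * Real.pi * Complex.I : ℂ) * ((k * α : ℝ) : ℂ) =
        2 * Real.pi * Complex.I * ((n : ℝ) : ℂ) := by
      push_cast
      rw [Complex.ofReal_one, div_one] at hn
      linear_combination hn
    have hkα : (k : ℝ) * α = n := by
      exact_mod_cast mul_left_cancel₀ Complex.two_pi_I_ne_zero hn'
    exact (hα.intCast_mul hk).ne_int n hkα
  have hsum : ∀ (n : ℕ) (x : AddCircle (1 : ℝ)), ∑ i ∈ Finset.range (q n),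
      fourier k (x + (((i : ℝ) * α : ℝ) : AddCircle (1 : ℝ))) =
      fourier k x * ((z ^ q n - 1) / (z - 1)) := by
    intro n x
    rw [← geom_sum_eq (sub_ne_zero.1 hz1), Finset.mul_sum]
    refine Finset.sum_congr rfl fun i _ => ?_
    rw [← hpow, fourier_apply, fourier_apply, fourier_apply, smul_add, AddCircle.toCircle_add,
      Circle.coe_mul]
  have hlim : Tendsto (fun n => ‖(z ^ q n - 1) / (z - 1)‖) atTop (𝓝 0) := by
    have h1 : Tendsto (fun n => z ^ q n) atTop (𝓝 1) := by
      have := ((fourier (T := (1 : ℝ)) k).continuous.tendsto 0).comp hq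
      rw [fourier_eval_zero] at this
      exact this.congr fun n => hpow (q n)
    simpa using ((h1.sub_const 1).div_const (z - 1)).norm
  rw [Metric.tendstoUniformly_iff]
  intro ε hε
  filter_upwards [hlim.eventually_lt_const hε] with n hn x
  rw [hsum, Pi.zero_apply, dist_zero_left, norm_mul, fourier_apply, Circle.norm_coe, one_mul]
  exact hn

/-- A trigonometric polynomial, minus its mean, has a zero-mean primitive whose Birkhoff sums tend
uniformly to zero along rigidity times. -/
theorem exists_isCirclePrimitive_of_mem_span_fourier {α : ℝ} (hα : Irrational α) {q : ℕ → ℕ}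
    (hq : Tendsto (fun n => (((q n : ℝ) * α : ℝ) : AddCircle (1 : ℝ))) atTop (𝓝 0))
    {S : C(AddCircle (1 : ℝ), ℂ)}
    (hS : S ∈ Submodule.span ℂ (Set.range (fourier (T := (1 : ℝ))))) :
    ∃ (P : AddCircle (1 : ℝ) → ℂ) (c : ℂ), IsCirclePrimitive P (fun t => S t - c) ∧
      ∫ t, P t = 0 ∧
      TendstoUniformly (fun n (x : AddCircle (1 : ℝ)) => ∑ i ∈ Finset.range (q n),
        P (x + (((i : ℝ) * α : ℝ) : AddCircle (1 : ℝ)))) 0 atTop := by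
  induction hS using Submodule.span_induction with
  | mem S hS =>
    obtain ⟨k, rfl⟩ := hS
    rcases eq_or_ne k 0 with rfl | hk
    · refine ⟨0, 1, ⟨by simp, by simp⟩, by simp, ?_⟩
      exact Metric.tendstoUniformly_iff.2 fun ε hε => by simp [hε]
    · set w : ℂ := (2 * Real.pi * Complex.I * k)⁻¹ with hw
      have hw0 : (2 * Real.pi * Complex.I * k : ℂ) ≠ 0 :=
        mul_ne_zero Complex.two_pi_I_ne_zero (by exact_mod_cast hk)
      have hprim : IsCirclePrimitive (fun t => w * fourier k t) (fun t => fourier k t - 0) := by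
        simp only [sub_zero]
        refine ⟨(fourier k).continuous.integrable_of_hasCompactSupport
          (HasCompactSupport.of_compactSpace _), fun a b => ?_⟩
        have hcont : Continuous fun t : ℝ => fourier k (t : AddCircle (1 : ℝ)) :=
          (fourier k).continuous.comp (AddCircle.continuous_mk' 1)
        refine (intervalIntegral.integral_eq_sub_of_hasDerivAt
          (f := fun t : ℝ => w * fourier k (t : AddCircle (1 : ℝ))) (fun t _ => ?_)
          (hcont.intervalIntegrable a b)).symm
        have := (hasDerivAt_fourier 1 k t).const_mul w
        rwa [Complex.ofReal_one, div_one, hw, inv_mul_cancel_left₀ hw0] at this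
      refine ⟨fun t => w * fourier k t, 0, hprim, ?_, ?_⟩
      · have := hprim.integral_eq_zero
        simp only [sub_zero] at this
        rw [integral_const_mul, this, mul_zero]
      · simp_rw [← Finset.mul_sum]
        have := (uniformContinuous_const_smul w).comp_tendstoUniformly
          (tendstoUniformly_birkhoffSum_fourier hα hq hk)
        convert! this using 1
        ext x
        simp
  | zero =>
    refine ⟨0, 0, ⟨by simp, by simp⟩, by simp, ?_⟩
    exact Metric.tendstoUniformly_iff.2 fun ε hε => by simp [hε]
  | add S S' _ _ ih ih' =>
    obtain ⟨P, c, hP, hP0, hPt⟩ := ih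
    obtain ⟨P', c', hP', hP0', hPt'⟩ := ih'
    refine ⟨fun t => P t + P' t, c + c', ⟨?_, fun a b => ?_⟩, ?_, ?_⟩
    · refine (hP.1.add hP'.1).congr (Eventually.of_forall fun t => ?_)
      simp only [ContinuousMap.add_apply, Pi.add_apply]
      ring
    · have := intervalIntegral.integral_add (intervalIntegrable_comp_coe_addCircle hP.1 a b)
        (intervalIntegrable_comp_coe_addCircle hP'.1 a b)
      rw [← hP.2, ← hP'.2] at this
      rw [add_sub_add_comm, ← this]
      congr 1 with t
      simp only [ContinuousMap.add_apply]
      ring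
    · rw [integral_add hP.integrable hP'.integrable, hP0, hP0', add_zero]
    · simp_rw [Finset.sum_add_distrib]
      have := hPt.add hPt'
      rwa [add_zero] at this
  | smul w S _ ih =>
    obtain ⟨P, c, hP, hP0, hPt⟩ := ih
    refine ⟨fun t => w * P t, w * c, ⟨?_, fun a b => ?_⟩, ?_, ?_⟩
    · refine (hP.1.const_mul w).congr (Eventually.of_forall fun t => ?_)
      simp only [ContinuousMap.smul_apply, smul_eq_mul]
      ring
    · rw [← mul_sub, hP.2, ← intervalIntegral.integral_const_mul]
      congr 1 with t
      simp only [ContinuousMap.smul_apply, smul_eq_mul]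
      ring
    · rw [integral_const_mul, hP0, mul_zero]
    · simp_rw [← Finset.mul_sum]
      have := (uniformContinuous_const_smul w).comp_tendstoUniformly hPt
      convert! this using 1
      ext x
      simp

/-- Trigonometric polynomials are dense in `L¹` of the circle. -/
theorem exists_mem_span_fourier_integral_norm_sub_le {G : AddCircle (1 : ℝ) → ℂ}
    (hG : Integrable G) {ε : ℝ} (hε : 0 < ε) :
    ∃ S ∈ Submodule.span ℂ (Set.range (fourier (T := (1 : ℝ)))), ∫ t, ‖G t - S t‖ ≤ ε := by
  obtain ⟨g, -, hg, hgc, hgi⟩ := hG.exists_hasCompactSupport_integral_sub_le (half_pos hε)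
  have hmem : (⟨g, hgc⟩ : C(AddCircle (1 : ℝ), ℂ)) ∈
      (Submodule.span ℂ (Set.range (fourier (T := (1 : ℝ))))).topologicalClosure := by
    rw [span_fourier_closure_eq_top]
    trivial
  obtain ⟨S, hS, hdist⟩ := Metric.mem_closure_iff.1 hmem (ε / 2) (half_pos hε)
  refine ⟨S, hS, ?_⟩
  have hSi : Integrable S := S.continuous.integrable_of_hasCompactSupport
    (HasCompactSupport.of_compactSpace _)
  have hsup : ∀ t, ‖g t - S t‖ ≤ ε / 2 := fun t => by
    rw [← dist_eq_norm]
    exact (ContinuousMap.dist_apply_le_dist (f := ⟨g, hgc⟩) t).trans hdist.le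
  calc ∫ t, ‖G t - S t‖ ≤ ∫ t, (‖(G - g) t‖ + ε / 2) := by
        refine integral_mono (hG.sub hSi).norm ((hG.sub hgi).norm.add (integrable_const _))
          fun t => ?_
        have := norm_sub_le_norm_sub_add_norm_sub (G t) (g t) (S t)
        exact this.trans (add_le_add_right (hsup t) _)
    _ ≤ ε := by
        rw [integral_add (hG.sub hgi).norm (integrable_const _), integral_const]
        simp only [Pi.sub_apply, measureReal_def, UnitAddCircle.measure_univ, ENNReal.toReal_one, one_smul]
        linarith

/-- An absolutely continuous function on the circle is a primitive of an integrable function. -/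
theorem AbsolutelyContinuous'.exists_isCirclePrimitive {φ : AddCircle (1 : ℝ) → ℝ}
    (h : AbsolutelyContinuous' φ) : ∃ G, IsCirclePrimitive (fun t => (φ t : ℂ)) G := by
  obtain ⟨g, hg, hφ⟩ := h
  set G : AddCircle (1 : ℝ) → ℂ := AddCircle.liftIoc 1 0 (fun t => (g t : ℂ)) with hGdef
  have hG : Integrable G := by
    rw [← memLp_one_iff_integrable]
    refine MemLp.memLp_liftIoc (memLp_one_iff_integrable.2 ?_)
    rw [zero_add]
    exact (hg.mono_set Set.Ioc_subset_Icc_self).ofReal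
  have hGint := intervalIntegrable_comp_coe_addCircle hG
  have hunit : ∀ x ∈ Set.Icc (0 : ℝ) 1,
      ∫ t in (0 : ℝ)..x, G t = (φ x : ℂ) - (φ (0 : ℝ) : ℂ) := by
    intro x hx
    rw [← Complex.ofReal_sub, hφ x hx, ← intervalIntegral.integral_ofReal]
    refine intervalIntegral.integral_congr_ae (Eventually.of_forall fun t ht => ?_)
    rw [Set.uIoc_of_le hx.1] at ht
    exact AddCircle.liftIoc_zero_coe_apply ⟨ht.1, ht.2.trans hx.2⟩
  have hper : Function.Periodic (fun t : ℝ => G t) 1 := fun t => by simp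
  have hzero : ∀ x : ℝ, ∫ t in (0 : ℝ)..x, G t = (φ x : ℂ) - (φ (0 : ℝ) : ℂ) := by
    have hprim : Function.Periodic (fun x : ℝ => ∫ t in (0 : ℝ)..x, G t) 1 := fun x => by
      have h1 := hunit 1 (by simp)
      rw [AddCircle.coe_period, AddCircle.coe_zero, sub_self] at h1
      simp only
      rw [hper.intervalIntegral_add_eq_add 0 x hGint, zero_add, h1, add_zero]
    intro x
    have hfract : ((Int.fract x : ℝ) : AddCircle (1 : ℝ)) = x := by
      rw [← Int.self_sub_floor, AddCircle.coe_sub]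
      simp
    have h1 := hprim.sub_int_mul_eq ⌊x⌋ (x := x)
    rw [mul_one, Int.self_sub_floor] at h1
    rw [← hfract, ← hunit _ ⟨Int.fract_nonneg x, (Int.fract_lt_one x).le⟩]
    exact h1.symm
  refine ⟨G, hG, fun a b => ?_⟩
  have := intervalIntegral.integral_add_adjacent_intervals (hGint 0 a) (hGint a b)
  rw [hzero, hzero] at this
  linear_combination -this

/-- Improved Denjoy–Koksma theorem: along a strictly increasing sequence of closest return
times `q_n`, the Birkhoff sums `φ_{q_n}` of a zero-mean absolutely continuous function tend
to `0` uniformly. -/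
theorem stmt_7 (α : ℝ) (hα : Irrational α) (φ : AddCircle (1 : ℝ) → ℝ)
    (hφac : AbsolutelyContinuous' φ) (hφint : ∫ x : AddCircle (1 : ℝ), φ x = 0)
    (q : ℕ → ℕ) (hmono : StrictMono q) (hcrt : ∀ n, IsClosestReturnTime α (q n)) :
    Tendsto (fun n => ⨆ x : AddCircle (1 : ℝ),
        |∑ i ∈ Finset.range (q n), φ (x + (((i : ℝ) * α : ℝ) : AddCircle (1 : ℝ)))|)
      atTop (𝓝 0) := by
  obtain ⟨G, hG⟩ := hφac.exists_isCirclePrimitive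
  have hφint' : ∫ t, (φ t : ℂ) = 0 := by
    rw [integral_complex_ofReal, hφint, Complex.ofReal_zero]
  have hrigid : Tendsto (fun n => (((q n : ℝ) * α : ℝ) : AddCircle (1 : ℝ))) atTop (𝓝 0) := by
    refine squeeze_zero_norm (a := fun n => 1 / ((q n : ℝ) + 1)) (fun n => ?_)
      (tendsto_one_div_add_atTop_nhds_zero_nat.comp hmono.tendsto_atTop)
    obtain ⟨-, -, -, h⟩ := (hcrt n).exists_isCoprime
    exact h
  rw [Metric.tendsto_atTop']
  intro ε hε
  obtain ⟨S, hS, hGS⟩ := exists_mem_span_fourier_integral_norm_sub_le hG.1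
    (by positivity : 0 < ε / 16)
  obtain ⟨P, c, hP, hP0, hPt⟩ := exists_isCirclePrimitive_of_mem_span_fourier hα hrigid hS
  have hSi : Integrable S := S.continuous.integrable_of_hasCompactSupport
    (HasCompactSupport.of_compactSpace _)
  have hc : ‖c‖ ≤ ε / 16 := by
    have h1 := hP.integral_eq_zero
    rw [integral_sub hSi (integrable_const c), integral_const] at h1
    simp only [measureReal_def, UnitAddCircle.measure_univ, ENNReal.toReal_one, one_smul] at h1
    have h2 : ∫ t, (G t - S t) = -c := by
      rw [integral_sub hG.1 hSi, hG.integral_eq_zero]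
      linear_combination -h1
    rw [← norm_neg, ← h2]
    exact (norm_integral_le_integral_norm _).trans hGS
  have hdiff := hG.sub hP
  have hL1 : ∫ t, ‖(G - fun t => S t - c) t‖ ≤ ε / 8 := by
    calc ∫ t, ‖(G - fun t => S t - c) t‖ ≤ ∫ t, (‖(G - S) t‖ + ‖c‖) := by
          refine integral_mono hdiff.1.norm ((hG.1.sub hSi).norm.add (integrable_const _))
            fun t => ?_
          simp only [Pi.sub_apply]
          rw [← sub_add]
          exact norm_add_le _ _
      _ ≤ ε / 8 := by
          rw [integral_add (hG.1.sub hSi).norm (integrable_const _), integral_const]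
          simp only [Pi.sub_apply, measureReal_def, UnitAddCircle.measure_univ, ENNReal.toReal_one, one_smul]
          linarith
  have hmean : ∫ t, ((fun t => (φ t : ℂ)) - P) t = 0 := by
    simp only [Pi.sub_apply]
    rw [integral_sub hG.integrable hP.integrable, hφint', hP0, sub_zero]
  obtain ⟨N, hN⟩ := eventually_atTop.1 (Metric.tendstoUniformly_iff.1 hPt (ε / 4) (by positivity))
  refine ⟨N, fun n hn => ?_⟩
  have hbound : ∀ x : AddCircle (1 : ℝ),
      |∑ i ∈ Finset.range (q n), φ (x + (((i : ℝ) * α : ℝ) : AddCircle (1 : ℝ)))| ≤ ε / 2 := by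
    intro x
    have h1 := hdiff.norm_birkhoffSum_le hmean (hcrt n) x
    have h2 := hN n hn.le x
    rw [Pi.zero_apply, dist_zero_left] at h2
    simp only [Pi.sub_apply, Finset.sum_sub_distrib] at h1 hL1
    rw [← Real.norm_eq_abs, ← Complex.norm_real]
    push_cast
    refine (norm_le_norm_sub_add _ _).trans ((add_le_add h1 h2.le).trans ?_)
    linarith
  rw [dist_zero_right, Real.norm_of_nonneg (Real.iSup_nonneg fun _ => abs_nonneg _)]
  exact (ciSup_le hbound).trans_lt (half_lt_self hε)
end
end
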